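/- arXiv:math/0507328 — 6 statements merged into one kernel-verified Lean document; each statement's English description precedes it below -/
import Mathlib

section
/- Let Y be a metrizable space and B a homotopy dense subset of Y. Then Y is an ANR if and only if B (with the subspace topology) is an ANR. -/
open TopologicalSpace

universe u

/-- `B` is homotopy dense in `Y`: there is a homotopy of the identity instantly
pushing `Y` into `B`. -/
def HomotopyDense {Y : Type*} [TopologicalSpace Y] (B : Set Y) : Prop :=
  ∃ f : C(unitInterval × Y, Y),
    (∀ y : Y, f (0, y) = y) ∧
    ∀ (t : unitInterval) (y : Y), t ≠ 0 → f (t, y) ∈ B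

/-- `X` is an absolute neighborhood retract. -/
def IsANR (X : Type u) [TopologicalSpace X] : Prop :=
  MetrizableSpace X ∧
    ∀ (Y : Type u) [TopologicalSpace Y], MetrizableSpace Y →
      ∀ B : Set Y, IsClosed B → ∀ f : C(B, X),
        ∃ (U : Set Y) (_ : IsOpen U) (hBU : B ⊆ U) (g : C(U, X)),
          ∀ b : B, g ⟨b.1, hBU b.2⟩ = f b

open Set Filter Topology

/-- If `O` is an open neighborhood of `A × (0, ∞)`, then there is a continuous function `τ`
vanishing on `A` whose graph over a punctured neighborhood of `A` lies in `O` at positive height. -/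
theorem exists_continuous_graph_subset {Z : Type*} [MetricSpace Z] {A : Set Z} (hA : IsClosed A)
    (hne : A.Nonempty) {O : Set (Z × ℝ)} (hO : IsOpen O)
    (hAO : ∀ a ∈ A, ∀ t : ℝ, 0 < t → (a, t) ∈ O) :
    ∃ U : Set Z, IsOpen U ∧ A ⊆ U ∧ ∃ τ : C(Z, ℝ), (∀ a ∈ A, τ a = 0) ∧
      ∀ z ∈ U, z ∉ A → 0 < τ z ∧ (z, τ z) ∈ O := by
  let C : ℕ → Set Z := fun n => {z | ∃ s ∈ Icc ((1 / 2 : ℝ) ^ n) 1, (z, s) ∉ O}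
  have hC : ∀ n, IsClosed (C n) := by
    intro n
    have hK : IsClosed {p : Z × Icc ((1 / 2 : ℝ) ^ n) 1 | (p.1, (p.2 : ℝ)) ∉ O} :=
      hO.isClosed_compl.preimage (f := fun p : Z × Icc ((1 / 2 : ℝ) ^ n) 1 => (p.1, (p.2 : ℝ)))
        (by fun_prop)
    convert isClosedMap_fst_of_compactSpace _ hK using 1
    ext z
    constructor
    · rintro ⟨s, hs, hz⟩
      exact ⟨(z, ⟨s, hs⟩), hz, rfl⟩
    · rintro ⟨⟨z, s⟩, hz, rfl⟩
      exact ⟨s, s.2, hz⟩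
  have hAC : ∀ n, Disjoint A (C n) := by
    intro n
    rw [Set.disjoint_left]
    rintro a ha ⟨s, hs, has⟩
    exact has (hAO a ha s (lt_of_lt_of_le (by positivity) hs.1))
  choose ψ hψ₀ hψ₁ hψ using fun n =>
    exists_continuous_zero_one_of_isClosed hA (hC (n + 1)) (hAC (n + 1))
  have hterm : ∀ n z, 0 ≤ (1 / 2 : ℝ) ^ n * ψ n z := fun n z =>
    mul_nonneg (by positivity) (hψ n z).1
  have hle : ∀ n z, ‖(1 / 2 : ℝ) ^ n * ψ n z‖ ≤ (1 / 2 : ℝ) ^ n := fun n z => by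
    rw [Real.norm_of_nonneg (hterm n z)]
    exact mul_le_of_le_one_right (by positivity) (hψ n z).2
  have hcont : Continuous fun z => ∑' n, (1 / 2 : ℝ) ^ n * ψ n z :=
    continuous_tsum (fun n => by fun_prop) summable_geometric_two hle
  have hsum : ∀ z, Summable fun n => (1 / 2 : ℝ) ^ n * ψ n z := fun z =>
    Summable.of_norm_bounded summable_geometric_two fun n => hle n z
  let τ : C(Z, ℝ) := ⟨fun z => min 1 (Metric.infDist z A + ∑' n, (1 / 2 : ℝ) ^ n * ψ n z),
    continuous_const.min ((Metric.continuous_infDist_pt A).add hcont)⟩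
  have hτ : ∀ z, τ z = min 1 (Metric.infDist z A + ∑' n, (1 / 2 : ℝ) ^ n * ψ n z) := fun _ => rfl
  refine ⟨(C 0)ᶜ, (hC 0).isOpen_compl, (hAC 0).subset_compl_right, τ, ?_, ?_⟩
  · intro a ha
    have h0 : ∀ n, ψ n a = 0 := fun n => hψ₀ n ha
    simp [hτ, h0, Metric.infDist_zero_of_mem ha]
  · intro z hz hzA
    have hd : 0 < Metric.infDist z A := (hA.notMem_iff_infDist_pos hne).1 hzA
    have hpos : 0 < τ z := by
      rw [hτ]
      exact lt_min one_pos (add_pos_of_pos_of_nonneg hd (tsum_nonneg fun n => hterm n z))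
    refine ⟨hpos, ?_⟩
    by_contra hzO
    have hle1 : τ z ≤ 1 := min_le_left _ _
    have hlt1 : τ z < 1 := by
      refine lt_of_le_of_ne hle1 fun h => hz ⟨1, by simp, ?_⟩
      rwa [h] at hzO
    obtain ⟨n, hn₁, hn₂⟩ :=
      exists_nat_pow_near_of_lt_one hpos hle1 (y := (1 / 2 : ℝ)) (by norm_num) (by norm_num)
    have hψn : ψ n z = 1 := hψ₁ n ⟨τ z, ⟨hn₁.le, hle1⟩, hzO⟩
    have hge := (hsum z).le_tsum n fun m _ => hterm m z
    rw [hψn, mul_one] at hge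
    have hτz : τ z = Metric.infDist z A + ∑' n, (1 / 2 : ℝ) ^ n * ψ n z := by
      rcases min_choice (1 : ℝ) (Metric.infDist z A + ∑' n, (1 / 2 : ℝ) ^ n * ψ n z) with h | h
      · exact absurd ((hτ z).trans h) hlt1.ne
      · exact (hτ z).trans h
    linarith

theorem IsANR.of_homotopyDense {Y : Type u} [TopologicalSpace Y] {B : Set Y}
    (hB : HomotopyDense B) (hY : IsANR Y) : IsANR B := by
  obtain ⟨F, hF₀, hFB⟩ := hB
  obtain ⟨hmY, hext⟩ := hY
  refine ⟨inferInstance, fun Z _ hZ A hA f => ?_⟩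
  let _ := metrizableSpaceMetric Z
  rcases A.eq_empty_or_nonempty with rfl | hne
  · exact ⟨∅, isOpen_empty, subset_rfl, ⟨fun z => z.2.elim, by
      rw [continuous_iff_continuousAt]; exact fun z => z.2.elim⟩, fun b => b.2.elim⟩
  obtain ⟨U, hU, hAU, g, hg⟩ := hext Z hZ A hA ⟨fun a => (f a : Y), by fun_prop⟩
  let s : Z → unitInterval := fun z => projIcc 0 1 zero_le_one (Metric.infDist z A)
  have hs : Continuous s := continuous_projIcc.comp (Metric.continuous_infDist_pt A)
  have hsA : ∀ z ∈ A, s z = 0 := fun z hz => by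
    simp only [s, Metric.infDist_zero_of_mem hz]
    exact projIcc_left _
  have hmem : ∀ z : U, F (s z, g z) ∈ B := by
    intro z
    by_cases hz : (z : Z) ∈ A
    · rw [hsA z hz, hF₀, hg ⟨z, hz⟩]
      exact (f ⟨z, hz⟩).2
    · refine hFB _ _ fun h => ?_
      have hd : 0 < Metric.infDist (z : Z) A := (hA.notMem_iff_infDist_pos hne).1 hz
      exact hd.not_ge ((projIcc_eq_left zero_lt_one).1 h)
  refine ⟨U, hU, hAU, ⟨fun z => ⟨F (s z, g z), hmem z⟩, by fun_prop⟩, fun b => ?_⟩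
  apply Subtype.ext
  change F (s b, g ⟨b, hAU b.2⟩) = f b
  rw [hsA b b.2, hF₀, hg b]
  rfl

theorem HomotopyDense.isANR {Y : Type u} [TopologicalSpace Y] [MetrizableSpace Y] {B : Set Y}
    (hB : HomotopyDense B) (hANR : IsANR B) : IsANR Y := by
  classical
  obtain ⟨F, hF₀, hFB⟩ := hB
  obtain ⟨-, hext⟩ := hANR
  refine ⟨inferInstance, fun Z _ hZ A hA f => ?_⟩
  let _ := metrizableSpaceMetric Z
  let _ := metrizableSpaceMetric Y
  rcases A.eq_empty_or_nonempty with rfl | hne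
  · exact ⟨∅, isOpen_empty, subset_rfl, ⟨fun z => z.2.elim, by
      rw [continuous_iff_continuousAt]; exact fun z => z.2.elim⟩, fun b => b.2.elim⟩
  let h : A × ℝ → Y := fun p => F (projIcc 0 1 zero_le_one p.2, f p.1)
  have hh : Continuous h := by
    have := continuous_projIcc (a := (0 : ℝ)) (b := 1) (h := zero_le_one)
    fun_prop
  have hh₀ : ∀ a, h (a, 0) = f a := fun a => by
    have h0 : projIcc (0 : ℝ) 1 zero_le_one 0 = 0 := projIcc_left _
    simp only [h, h0, hF₀]
  have hhB : ∀ a t, 0 < t → h (a, t) ∈ B := fun a t ht =>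
    hFB _ _ fun h0 => ht.not_ge ((projIcc_eq_left zero_lt_one).1 h0)
  obtain ⟨W, hW, hAW, G, hG⟩ := hext (Z × Ioi (0 : ℝ)) inferInstance (Prod.fst ⁻¹' A)
    (hA.preimage continuous_fst)
    ⟨fun p => ⟨h (⟨p.1.1, p.2⟩, p.1.2), hhB _ _ p.1.2.2⟩, by fun_prop⟩
  let ι : W → Z × ℝ := fun w => (w.1.1, (w.1.2 : ℝ))
  have hι : IsOpenEmbedding ι :=
    (IsOpenEmbedding.id.prodMap isOpen_Ioi.isOpenEmbedding_subtypeVal).comp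
      hW.isOpenEmbedding_subtypeVal
  let S : Set W := {w | ∃ a : A, dist w.1.1 a < w.1.2 ∧ dist (G w : Y) (h (a, w.1.2)) < w.1.2}
  have hS : IsOpen S := by
    simp only [S, ofPred_exists]
    refine isOpen_iUnion fun a => IsOpen.and (isOpen_lt ?_ ?_) (isOpen_lt ?_ ?_) <;> fun_prop
  obtain ⟨U, hU, hAU, τ, hτ₀, hτ⟩ := exists_continuous_graph_subset hA hne
    (hι.isOpenMap S hS) (by
      intro a ha t ht
      refine ⟨⟨(a, ⟨t, ht⟩), hAW ha⟩, ⟨⟨a, ha⟩, by simpa using ht, ?_⟩, rfl⟩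
      rw [hG ⟨(a, ⟨t, ht⟩), ha⟩]
      simpa using ht)
  let Gext : Z × ℝ → Y := Function.extend ι (fun w => (G w : Y)) fun _ => f ⟨_, hne.some_mem⟩
  have hGext : ∀ w, Gext (ι w) = G w := fun w => hι.injective.extend_apply _ _ w
  have hGext_cont : ∀ w, ContinuousAt Gext (ι w) := fun w => by
    rw [← hι.continuousAt_iff]
    have : Gext ∘ ι = fun w => (G w : Y) := funext hGext
    rw [this]
    fun_prop
  let g : Z → Y := fun z => if hz : z ∈ A then f ⟨z, hz⟩ else Gext (z, τ z)
  have hgA : ∀ a : A, g a = f a := fun a => dif_pos a.2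
  have hgN : ∀ z, z ∉ A → g z = Gext (z, τ z) := fun z hz => dif_neg hz
  have hg : ∀ z ∈ U, ContinuousAt g z := by
    intro z hz
    by_cases hzA : z ∈ A
    · rw [Metric.continuousAt_iff']
      intro ε hε
      obtain ⟨δ, hδ, hhδ⟩ := Metric.continuousAt_iff.1
        (hh.continuousAt (x := ((⟨z, hzA⟩ : A), (0 : ℝ)))) (ε / 2) (half_pos hε)
      have hτz : ∀ᶠ w in 𝓝 z, τ w < min (δ / 2) (ε / 2) :=
        τ.continuous.continuousAt.eventually_lt continuousAt_const
          (by rw [hτ₀ z hzA]; positivity)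
      filter_upwards [hU.mem_nhds hz, Metric.ball_mem_nhds z (half_pos hδ), hτz]
        with w hwU hwz hwτ
      rw [Metric.mem_ball] at hwz
      rw [hgA ⟨z, hzA⟩, ← hh₀ ⟨z, hzA⟩]
      by_cases hwA : w ∈ A
      · rw [hgA ⟨w, hwA⟩, ← hh₀ ⟨w, hwA⟩]
        refine (hhδ ?_).trans (half_lt_self hε)
        rw [Prod.dist_eq, dist_self]
        exact max_lt (hwz.trans (half_lt_self hδ)) hδ
      · obtain ⟨hpos, v, ⟨a, hva, hvG⟩, hv⟩ := hτ w hwU hwA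
        have hgw : g w = G v := by rw [← hGext, hv, hgN w hwA]
        have hv₁ : v.1.1 = w := congrArg Prod.fst hv
        have hv₂ : (v.1.2 : ℝ) = τ w := congrArg Prod.snd hv
        rw [hv₁, hv₂] at hva
        rw [hv₂] at hvG
        have hτδ := hwτ.trans_le (min_le_left _ _)
        have hτε := hwτ.trans_le (min_le_right _ _)
        have haz : dist a ⟨z, hzA⟩ < δ := by
          rw [Subtype.dist_eq]
          linarith [dist_triangle_left (a : Z) z w]
        have hclose := @hhδ (a, τ w) (by
          rw [Prod.dist_eq]
          refine max_lt haz ?_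
          rw [Real.dist_0_eq_abs, abs_of_pos hpos]
          linarith)
        rw [hgw]
        linarith [dist_triangle (G v : Y) (h (a, τ w)) (h (⟨z, hzA⟩, 0))]
    · obtain ⟨-, v, -, hv⟩ := hτ z hz hzA
      have hc : ContinuousAt (fun z => Gext (z, τ z)) z :=
        ContinuousAt.comp (g := Gext) (f := fun z => (z, τ z)) (hv ▸ hGext_cont v) (by fun_prop)
      refine hc.congr ?_
      filter_upwards [hA.isOpen_compl.mem_nhds hzA] with w hw
      exact (hgN w hw).symm
  exact ⟨U, hU, hAU, ⟨fun z => g z, continuous_iff_continuousAt.2 fun z =>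
    (hg z z.2).comp continuous_subtype_val.continuousAt⟩, hgA⟩

theorem stmt5 {Y : Type u} [TopologicalSpace Y] [MetrizableSpace Y] (B : Set Y)
    (hB : HomotopyDense B) :
    IsANR Y ↔ IsANR ↥B := by
  exact ⟨IsANR.of_homotopyDense hB, hB.isANR⟩
end

section
/- Let Y be a locally compact separable metrizable space, A a closed subset of Y, ι an index type, l a filter on ι, and let μ_i (i ∈ ι) and μ be Radon measures on Y such that μ_i → μ vaguely along l and μ(Fr A) = 0, where Fr A denotes the topological frontier of A. Then the restrictions converge vaguely: for every continuous f : Y → ℝ with compact support, ∫ f dμ_i|_A → ∫ f dμ|_A along l, where μ|_A denotes the restriction of μ to A (μ|_A(B) = μ(B ∩ A) for Borel B). -/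
open MeasureTheory TopologicalSpace Filter

/-- `μs i → μ` vaguely along `l`: integrals of compactly supported continuous
real functions converge. -/
def TendstoVaguely {ι Y : Type*} [TopologicalSpace Y] [MeasurableSpace Y]
    (l : Filter ι) (μs : ι → Measure Y) (μ : Measure Y) : Prop :=
  ∀ f : C(Y, ℝ), HasCompactSupport f →
    Tendsto (fun i => ∫ x, f x ∂(μs i)) l (nhds (∫ x, f x ∂μ))

/-- If `F` can be sandwiched, up to small `μ`-integral, by compactly supported continuous functions,
then its integrals converge along any vaguely convergent family of measures. -/
theorem TendstoVaguely.tendsto_integral_of_forall_exists_abs_sub_le {ι Y : Type*}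
    [TopologicalSpace Y] [MeasurableSpace Y] [OpensMeasurableSpace Y]
    {l : Filter ι} {μs : ι → Measure Y} {μ : Measure Y}
    [∀ i, IsFiniteMeasureOnCompacts (μs i)] [IsFiniteMeasureOnCompacts μ]
    (hconv : TendstoVaguely l μs μ) {F : Y → ℝ}
    (hFs : ∀ i, Integrable F (μs i)) (hF : Integrable F μ)
    (happrox : ∀ ε > 0, ∃ φ ψ : C(Y, ℝ), HasCompactSupport φ ∧ HasCompactSupport ψ ∧
      (∀ x, |F x - φ x| ≤ ψ x) ∧ ∫ x, ψ x ∂μ < ε) :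
    Tendsto (fun i => ∫ x, F x ∂(μs i)) l (nhds (∫ x, F x ∂μ)) := by
  rw [Metric.tendsto_nhds]
  intro ε hε
  obtain ⟨φ, ψ, hφ, hψ, hle, hlt⟩ := happrox (ε / 3) (by positivity)
  have key : ∀ ν : Measure Y, IsFiniteMeasureOnCompacts ν → Integrable F ν →
      |∫ x, F x ∂ν - ∫ x, φ x ∂ν| ≤ ∫ x, ψ x ∂ν := by
    intro ν _ hFν
    rw [← integral_sub hFν (φ.continuous.integrable_of_hasCompactSupport hφ)]
    exact norm_integral_le_of_norm_le (ψ.continuous.integrable_of_hasCompactSupport hψ)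
      (ae_of_all _ fun x => (Real.norm_eq_abs _).trans_le (hle x))
  filter_upwards [(hconv ψ hψ).eventually_lt_const hlt,
    Metric.tendsto_nhds.1 (hconv φ hφ) (ε / 3) (by positivity)] with i hi₁ hi₂
  have h₁ := abs_le.1 (key (μs i) inferInstance (hFs i))
  have h₂ := abs_le.1 (key μ inferInstance hF)
  rw [Real.dist_eq, abs_lt] at hi₂ ⊢
  constructor <;> linarith [h₁.1, h₁.2, h₂.1, h₂.2, hi₂.1, hi₂.2]

/-- A compactly supported continuous function cut off to a closed set with `μ`-null frontier is
approximated by a compactly supported continuous function, with continuous error bound of small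
`μ`-integral. -/
theorem exists_continuousMap_abs_indicator_sub_le_of_measure_frontier_eq_zero {Y : Type*}
    [TopologicalSpace Y] [MeasurableSpace Y] [OpensMeasurableSpace Y] [HasOuterApproxClosed Y]
    {μ : Measure Y} [IsFiniteMeasureOnCompacts μ] {A : Set Y} (hA : IsClosed A)
    (hfr : μ (frontier A) = 0) (f : C(Y, ℝ)) (hf : HasCompactSupport f) {ε : ℝ} (hε : 0 < ε) :
    ∃ φ ψ : C(Y, ℝ), HasCompactSupport φ ∧ HasCompactSupport ψ ∧
      (∀ x, |A.indicator f x - φ x| ≤ ψ x) ∧ ∫ x, ψ x ∂μ < ε := by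
  have hB : IsClosed (closure Aᶜ) := isClosed_closure
  let g : ℕ → C(Y, ℝ) := fun n => ⟨fun x => hA.apprSeq n x, by fun_prop⟩
  let k : ℕ → C(Y, ℝ) := fun n => ⟨fun x => hB.apprSeq n x, by fun_prop⟩
  let ψ : ℕ → C(Y, ℝ) := fun n => |f| * (g n + k n - 1)
  have hg₀ : ∀ n x, 0 ≤ g n x := fun n x => NNReal.coe_nonneg _
  have hk₀ : ∀ n x, 0 ≤ k n x := fun n x => NNReal.coe_nonneg _
  have hg₁ : ∀ n x, g n x ≤ 1 := fun n x => mod_cast HasOuterApproxClosed.apprSeq_apply_le_one hA n x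
  have hk₁ : ∀ n x, k n x ≤ 1 := fun n x => mod_cast HasOuterApproxClosed.apprSeq_apply_le_one hB n x
  have hgA : ∀ n, ∀ x ∈ A, g n x = 1 := fun n x hx =>
    NNReal.coe_eq_one.2 (HasOuterApproxClosed.apprSeq_apply_eq_one hA n hx)
  have hkB : ∀ n, ∀ x ∈ closure Aᶜ, k n x = 1 := fun n x hx =>
    NNReal.coe_eq_one.2 (HasOuterApproxClosed.apprSeq_apply_eq_one hB n hx)
  have hψ_apply : ∀ n x, ψ n x = |f x| * (g n x + k n x - 1) := fun n x => rfl
  have hψ_supp : ∀ n, HasCompactSupport (ψ n) := fun n =>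
    (hf.comp_left (g := fun y : ℝ => |y|) abs_zero).mul_right
  have hlim : Tendsto (fun n => ∫ x, ψ n x ∂μ) atTop (nhds (∫ _, (0 : ℝ) ∂μ)) := by
    refine tendsto_integral_of_dominated_convergence (fun x => |f x|)
      (fun n => ((ψ n).continuous.integrable_of_hasCompactSupport (hψ_supp n)).1)
      (f.continuous.integrable_of_hasCompactSupport hf).abs (fun n => ae_of_all _ fun x => ?_) ?_
    · rw [hψ_apply, Real.norm_eq_abs, abs_mul, abs_abs]
      refine mul_le_of_le_one_right (abs_nonneg _) (abs_le.2 ⟨?_, ?_⟩) <;>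
        linarith [hg₀ n x, hk₀ n x, hg₁ n x, hk₁ n x]
    · filter_upwards [measure_eq_zero_iff_ae_notMem.1 hfr] with x hx
      have hgl : Tendsto (fun n => g n x) atTop
          (nhds ((A.indicator (fun _ => (1 : NNReal)) x : NNReal) : ℝ)) :=
        NNReal.tendsto_coe.2
          (tendsto_pi_nhds.1 (HasOuterApproxClosed.tendsto_apprSeq hA) x)
      have hkl : Tendsto (fun n => k n x) atTop
          (nhds (((closure Aᶜ).indicator (fun _ => (1 : NNReal)) x : NNReal) : ℝ)) :=
        NNReal.tendsto_coe.2
          (tendsto_pi_nhds.1 (HasOuterApproxClosed.tendsto_apprSeq hB) x)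
      have hsum : Tendsto (fun n => ψ n x) atTop _ :=
        ((hgl.add hkl).sub_const 1).const_mul |f x|
      convert hsum using 2
      rw [frontier_eq_closure_inter_closure, hA.closure_eq] at hx
      by_cases hxA : x ∈ A
      · have hxB : x ∉ closure Aᶜ := fun h => hx ⟨hxA, h⟩
        simp [hxA, hxB, -closure_compl]
      · have hxB : x ∈ closure Aᶜ := subset_closure hxA
        simp [hxA, hxB, -closure_compl]
  rw [integral_zero] at hlim
  obtain ⟨n, hn⟩ := (hlim.eventually_lt_const hε).exists
  refine ⟨f * g n, ψ n, hf.mul_right, hψ_supp n, fun x => ?_, hn⟩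
  rw [hψ_apply, ContinuousMap.mul_apply]
  by_cases hxA : x ∈ A
  · rw [Set.indicator_of_mem hxA, hgA n x hxA, mul_one, sub_self, abs_zero]
    exact mul_nonneg (abs_nonneg _) (by linarith [hk₀ n x])
  · rw [Set.indicator_of_notMem hxA, hkB n x (subset_closure hxA), zero_sub, abs_neg, abs_mul,
      abs_of_nonneg (hg₀ n x), add_sub_cancel_right]

theorem stmt6 {ι Y : Type*} [TopologicalSpace Y] [LocallyCompactSpace Y]
    [SeparableSpace Y] [MetrizableSpace Y] [MeasurableSpace Y] [BorelSpace Y]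
    (A : Set Y) (hA : IsClosed A)
    (l : Filter ι) (μs : ι → Measure Y) (μ : Measure Y)
    (hμs : ∀ i, IsFiniteMeasureOnCompacts (μs i)) (hμ : IsFiniteMeasureOnCompacts μ)
    (hconv : TendstoVaguely l μs μ)
    (hfr : μ (frontier A) = 0) :
    TendstoVaguely l (fun i => (μs i).restrict A) (μ.restrict A) := by
  intro f hf
  let _ : MetricSpace Y := metrizableSpaceMetric Y
  simp_rw [← integral_indicator hA.measurableSet]
  exact hconv.tendsto_integral_of_forall_exists_abs_sub_le
    (fun i => (f.continuous.integrable_of_hasCompactSupport hf).indicator hA.measurableSet)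
    ((f.continuous.integrable_of_hasCompactSupport hf).indicator hA.measurableSet)
    fun _ hε =>
      exists_continuousMap_abs_indicator_sub_le_of_measure_frontier_eq_zero hA hfr f hf hε
end

section
/- Let Y and Z be locally compact separable metrizable spaces, E ⊆ Y and F ⊆ Z closed sets, and f : Y → Z a continuous proper surjection such that f(E) = F, f(Y ∖ E) = Z ∖ F, and the restriction of f to Y ∖ E is a homeomorphism onto Z ∖ F. Then the pushforward map μ ↦ f_*μ is a bijection from the set of Radon measures μ on Y with μ(E) = 0 onto the set of Radon measures ν on Z with ν(F) = 0, whose inverse sends ν to the measure f^*ν defined on Borel sets B ⊆ Y by (f^*ν)(B) = ν(f(B ∖ E)). -/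
open MeasureTheory TopologicalSpace

/-- A map which is injective off a set `E`, with `E` and its complement saturated, satisfies
`f ⁻¹' (f '' (B \ E)) = B \ E`. -/
theorem preimage_image_diff_of_injOn_compl {Y Z : Type*} {E : Set Y} {F : Set Z} {f : Y → Z}
    (hpre : f ⁻¹' F = E) (hinj : Set.InjOn f Eᶜ) (B : Set Y) :
    f ⁻¹' (f '' (B \ E)) = B \ E := by
  refine Set.Subset.antisymm ?_ (Set.subset_preimage_image f _)
  rintro x ⟨y, ⟨hyB, hyE⟩, hyx⟩
  have hxE : x ∉ E := by
    rw [← hpre, Set.mem_preimage, ← hyx, ← Set.mem_preimage, hpre]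
    exact hyE
  rw [← hinj hyE hxE hyx]
  exact ⟨hyB, hyE⟩

/-- A measure vanishing on `E` is recovered from its pushforward along a map injective off `E`. -/
theorem apply_eq_map_image_diff {Y Z : Type*} [MeasurableSpace Y] [MeasurableSpace Z]
    {E : Set Y} {F : Set Z} {f : Y → Z} (hf : Measurable f)
    (hpre : f ⁻¹' F = E) (hinj : Set.InjOn f Eᶜ) {μ : Measure Y} (hμ : μ E = 0) {B : Set Y}
    (hB : MeasurableSet (f '' (B \ E))) :
    μ B = μ.map f (f '' (B \ E)) := by
  rw [Measure.map_apply hf hB, preimage_image_diff_of_injOn_compl hpre hinj,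
    measure_sdiff_null hμ]

theorem stmt8 {Y Z : Type*}
    [TopologicalSpace Y] [LocallyCompactSpace Y] [SeparableSpace Y] [MetrizableSpace Y]
    [MeasurableSpace Y] [BorelSpace Y]
    [TopologicalSpace Z] [LocallyCompactSpace Z] [SeparableSpace Z] [MetrizableSpace Z]
    [MeasurableSpace Z] [BorelSpace Z]
    (E : Set Y) (hE : IsClosed E) (F : Set Z) (hF : IsClosed F)
    (f : Y → Z) (hf : Continuous f) (hfsurj : Function.Surjective f)
    (hproper : ∀ K : Set Z, IsCompact K → IsCompact (f ⁻¹' K))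
    (hEF : f '' E = F) (hEFc : f '' Eᶜ = Fᶜ)
    -- the restriction of `f` to `Y ∖ E` is a homeomorphism onto `Z ∖ F`:
    (hhomeo : ∃ g : ↥Eᶜ ≃ₜ ↥Fᶜ, ∀ y : ↥Eᶜ, (g y : Z) = f y) :
    Set.BijOn (fun μ : Measure Y => Measure.map f μ)
      {μ : Measure Y | IsFiniteMeasureOnCompacts μ ∧ μ E = 0}
      {ν : Measure Z | IsFiniteMeasureOnCompacts ν ∧ ν F = 0} ∧
    -- the inverse sends `ν` to the measure `f^*ν`, `(f^*ν)(B) = ν(f(B ∖ E))`: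
    ∀ ν : Measure Z, IsFiniteMeasureOnCompacts ν → ν F = 0 →
      ∃ μ : Measure Y, (IsFiniteMeasureOnCompacts μ ∧ μ E = 0) ∧
        Measure.map f μ = ν ∧
        ∀ B : Set Y, MeasurableSet B → μ B = ν (f '' (B \ E)) := by
  obtain ⟨g, hg⟩ := hhomeo
  have hpre : f ⁻¹' F = E := by
    refine Set.Subset.antisymm (fun y hy => ?_) (fun y hy => hEF ▸ Set.mem_image_of_mem f hy)
    by_contra hyE
    exact (hEFc ▸ Set.mem_image_of_mem f hyE : f y ∈ Fᶜ) hy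
  have hinj : Set.InjOn f Eᶜ := fun x hx y hy hxy =>
    congrArg Subtype.val (g.injective (a₁ := ⟨x, hx⟩) (a₂ := ⟨y, hy⟩)
      (Subtype.ext (by rw [hg, hg]; exact hxy)))
  have hemb : MeasurableEmbedding (fun y : ↥Eᶜ => f y) := by
    have h := (MeasurableEmbedding.subtype_coe hF.measurableSet.compl).comp
      g.measurableEmbedding
    rwa [show (Subtype.val ∘ g) = fun y : ↥Eᶜ => f y from funext hg] at h
  have himage : ∀ B : Set Y,
      (fun y : ↥Eᶜ => f y) '' (Subtype.val ⁻¹' B) = f '' (B \ E) := by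
    intro B
    rw [← Set.image_image f Subtype.val, Subtype.image_preimage_coe, Set.inter_comm,
      Set.sdiff_eq]
  have hmeas : ∀ B : Set Y, MeasurableSet B → MeasurableSet (f '' (B \ E)) := fun B hB =>
    himage B ▸ hemb.measurableSet_image.2 (measurable_subtype_coe hB)
  have hpull : ∀ ν : Measure Z, IsFiniteMeasureOnCompacts ν → ν F = 0 →
      ∃ μ : Measure Y, (IsFiniteMeasureOnCompacts μ ∧ μ E = 0) ∧
        Measure.map f μ = ν ∧
        ∀ B : Set Y, MeasurableSet B → μ B = ν (f '' (B \ E)) := by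
    intro ν hν hνF
    have happ : ∀ B : Set Y, MeasurableSet B →
        (ν.comap fun y : ↥Eᶜ => f y).map Subtype.val B = ν (f '' (B \ E)) := fun B hB => by
      rw [Measure.map_apply measurable_subtype_coe hB, hemb.comap_apply, himage]
    refine ⟨(ν.comap fun y : ↥Eᶜ => f y).map Subtype.val, ⟨⟨fun K hK => ?_⟩, ?_⟩, ?_, happ⟩
    · rw [happ K hK.measurableSet]
      exact (measure_mono (Set.image_mono Set.sdiff_subset)).trans_lt
        (hK.image hf).measure_lt_top
    · rw [happ E hE.measurableSet, Set.sdiff_self, Set.image_empty, measure_empty]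
    · ext C hC
      rw [Measure.map_apply hf.measurable hC, happ _ (hf.measurable hC), Set.sdiff_eq,
        Set.image_preimage_inter, hEFc, ← Set.sdiff_eq, measure_sdiff_null hνF]
  refine ⟨⟨?_, ?_, ?_⟩, hpull⟩
  · rintro μ ⟨hμ, hμE⟩
    refine ⟨⟨fun K hK => ?_⟩, ?_⟩
    · rw [Measure.map_apply hf.measurable hK.measurableSet]
      exact (hproper K hK).measure_lt_top
    · rw [Measure.map_apply hf.measurable hF.measurableSet, hpre, hμE]
  · rintro μ ⟨-, hμE⟩ μ' ⟨-, hμE'⟩ (h : μ.map f = μ'.map f)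
    ext B hB
    rw [apply_eq_map_image_diff hf.measurable hpre hinj hμE (hmeas B hB), h,
      ← apply_eq_map_image_diff hf.measurable hpre hinj hμE' (hmeas B hB)]
  · rintro ν ⟨hν, hνF⟩
    obtain ⟨μ, hμ, hmap, -⟩ := hpull ν hν hνF
    exact ⟨μ, hμ, hmap⟩
end

section
/- Let Y be a connected, locally connected, locally compact, separable metrizable space, let h be a homeomorphism of Y belonging to 𝓗(Y)₀ (the connected component of the identity in the space of homeomorphisms of Y with the compact-open topology), and let e be an end of Y. Then h(e) = e; that is, for every compact K ⊆ Y, h(e(h⁻¹(K))) = e(K). -/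
open TopologicalSpace

/-- The set of homeomorphisms of `M`, as a subset of `C(M, M)` (compact-open topology). -/
def HomeoSet (M : Type*) [TopologicalSpace M] : Set C(M, M) :=
  {f | IsHomeomorph f}

/-- The identity component `𝓗(M)₀` of the homeomorphism group of `M`. -/
def HomeoIdComp (M : Type*) [TopologicalSpace M] : Set C(M, M) :=
  connectedComponentIn (HomeoSet M) (ContinuousMap.id M)

/-- An end of the space `Y`: a choice, for each compact `K ⊆ Y`, of a connected
component of `Y ∖ K`, decreasing in `K`. The function `comp` is defined on all
sets, but its defining properties are only required for compact sets. -/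
structure SpaceEnd (Y : Type*) [TopologicalSpace Y] where
  comp : Set Y → Set Y
  mem_components : ∀ K : Set Y, IsCompact K →
    ∃ x ∈ Kᶜ, comp K = connectedComponentIn Kᶜ x
  antitone : ∀ K₁ K₂ : Set Y, IsCompact K₁ → IsCompact K₂ → K₁ ⊆ K₂ →
    comp K₂ ⊆ comp K₁

/-- A preconnected set which meets both `t` and its complement meets the frontier of `t`. -/
theorem IsPreconnected.inter_frontier_nonempty {X : Type*} [TopologicalSpace X] {s t : Set X}
    (hs : IsPreconnected s) (ht : (s ∩ t).Nonempty) (htc : (s ∩ tᶜ).Nonempty) :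
    (s ∩ frontier t).Nonempty := by
  by_contra hfr
  have hfr' : ∀ x ∈ s, x ∈ closure t → x ∈ interior t := fun x hx hxt => by
    by_contra hxi
    exact hfr ⟨x, hx, hxt, hxi⟩
  obtain ⟨a, has, hat⟩ := ht
  obtain ⟨b, hbs, hbt⟩ := htc
  obtain ⟨c, -, hci, hcc⟩ := hs (interior t) (closure t)ᶜ isOpen_interior
    isClosed_closure.isOpen_compl
    (fun x hx => (em (x ∈ closure t)).imp (hfr' x hx) id)
    ⟨a, has, hfr' a has (subset_closure hat)⟩
    ⟨b, hbs, fun hb => hbt (interior_subset (hfr' b hbs hb))⟩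
  exact hcc (interior_subset_closure hci)

open Set Filter Topology in
/-- Inversion is continuous at a homeomorphism `f` in the compact-open sense: if `K` is compact and
contained in the interior of a compact set `L`, then `g ⁻¹' K ⊆ f ⁻¹' L` for all homeomorphisms `g`
close to `f`. -/
theorem eventually_preimage_subset_preimage {Y : Type*} [TopologicalSpace Y]
    [LocallyConnectedSpace Y] [LocallyCompactSpace Y] [T2Space Y]
    {f : C(Y, Y)} (hf : f ∈ HomeoSet Y) {K L : Set Y} (hK : IsCompact K) (hL : IsCompact L)
    (hKL : K ⊆ interior L) :
    ∀ᶠ g : C(Y, Y) in 𝓝[HomeoSet Y] f, g ⁻¹' K ⊆ f ⁻¹' L := by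
  have hf' : IsHomeomorph f := hf
  have hF : IsCompact (f ⁻¹' L) := (hf'.homeomorph f).isCompact_preimage.2 hL
  refine hK.induction_on (p := fun s => ∀ᶠ g : C(Y, Y) in 𝓝[HomeoSet Y] f, g ⁻¹' s ⊆ f ⁻¹' L)
    (by simp) (fun s t hst ht => ?_) (fun s t hs ht => ?_) (fun y hy => ?_)
  · filter_upwards [ht] with g hg using (preimage_mono hst).trans hg
  · filter_upwards [hs, ht] with g hgs hgt using union_subset hgs hgt
  obtain ⟨C, hC, hyC, hCL⟩ := exists_compact_subset isOpen_interior (hKL hy)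
  obtain ⟨x, rfl⟩ := hf'.surjective y
  have hVo : IsOpen (connectedComponentIn (interior C) (f x)) :=
    isOpen_interior.connectedComponentIn
  have hxV : f x ∈ connectedComponentIn (interior C) (f x) := mem_connectedComponentIn hyC
  have hVC : connectedComponentIn (interior C) (f x) ⊆ C :=
    (connectedComponentIn_subset _ _).trans interior_subset
  refine ⟨_, mem_nhdsWithin_of_mem_nhds (hVo.mem_nhds hxV), ?_⟩
  have hfr : MapsTo f (frontier (f ⁻¹' L)) Cᶜ := by
    intro z hz hzC
    have hz' : z ∈ f ⁻¹' frontier L := by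
      have := (hf'.homeomorph f).preimage_frontier L
      exact this.symm ▸ hz
    exact hz'.2 (hCL hzC)
  have hfrc : IsCompact (frontier (f ⁻¹' L)) :=
    hF.of_isClosed_subset isClosed_frontier hF.isClosed.frontier_subset
  have hev₁ : ∀ᶠ g : C(Y, Y) in 𝓝[HomeoSet Y] f, MapsTo g (frontier (f ⁻¹' L)) Cᶜ :=
    (ContinuousMap.eventually_mapsTo hfrc hC.isClosed.isOpen_compl hfr).filter_mono
      nhdsWithin_le_nhds
  have hev₂ : ∀ᶠ g : C(Y, Y) in 𝓝[HomeoSet Y] f, g x ∈ connectedComponentIn (interior C) (f x) :=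
    ((continuous_eval_const (F := C(Y, Y)) x).continuousAt.eventually
      (hVo.mem_nhds hxV)).filter_mono nhdsWithin_le_nhds
  filter_upwards [hev₁, hev₂, self_mem_nhdsWithin] with g hg₁ hg₂ hg
  have hg' : IsHomeomorph g := hg
  have hconn : IsPreconnected (g ⁻¹' connectedComponentIn (interior C) (f x)) :=
    (hg'.homeomorph g).isPreconnected_preimage.2 isPreconnected_connectedComponentIn
  intro z hz
  by_contra hzF
  obtain ⟨w, hwV, hwF⟩ := hconn.inter_frontier_nonempty (t := f ⁻¹' L)
    ⟨x, hg₂, (hCL.trans interior_subset) (hVC hxV)⟩ ⟨z, hz, hzF⟩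
  exact hg₁ hwF (hVC hwV)

namespace SpaceEnd

variable {Y : Type*} [TopologicalSpace Y]

theorem comp_nonempty (e : SpaceEnd Y) {K : Set Y} (hK : IsCompact K) : (e.comp K).Nonempty := by
  obtain ⟨x, hx, h⟩ := e.mem_components K hK
  exact ⟨x, h ▸ mem_connectedComponentIn hx⟩

/-- The image of an end under a homeomorphism takes components as values. -/
theorem exists_image_comp_eq (e : SpaceEnd Y) {g : C(Y, Y)} (hg : g ∈ HomeoSet Y) {K : Set Y}
    (hK : IsCompact K) :
    ∃ y, g '' e.comp (g ⁻¹' K) = connectedComponentIn Kᶜ y := by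
  have hg' : IsHomeomorph g := hg
  obtain ⟨x, hx, h⟩ := e.mem_components (g ⁻¹' K) ((hg'.homeomorph g).isCompact_preimage.2 hK)
  refine ⟨g x, ?_⟩
  have himage := (hg'.homeomorph g).image_connectedComponentIn hx
  rw [h]
  refine himage.trans ?_
  change connectedComponentIn (g '' (g ⁻¹' Kᶜ)) (g x) = _
  rw [Set.image_preimage_eq _ hg'.surjective]

open Set Filter Topology in
/-- The value at `K` of the image of an end under a homeomorphism `g` is locally constant in `g`. -/
theorem eventually_image_comp_eq [LocallyConnectedSpace Y] [LocallyCompactSpace Y] [T2Space Y]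
    (e : SpaceEnd Y) {f : C(Y, Y)} (hf : f ∈ HomeoSet Y) {K : Set Y} (hK : IsCompact K) :
    ∀ᶠ g : C(Y, Y) in 𝓝[HomeoSet Y] f, f '' e.comp (f ⁻¹' K) = g '' e.comp (g ⁻¹' K) := by
  have hcompact {g : C(Y, Y)} (hg : IsHomeomorph g) {S : Set Y} (hS : IsCompact S) :
      IsCompact (g ⁻¹' S) := (hg.homeomorph g).isCompact_preimage.2 hS
  obtain ⟨L, hL, hKL⟩ := exists_compact_superset hK
  obtain ⟨p, hp⟩ := e.comp_nonempty (hcompact hf hL)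
  obtain ⟨y, hy⟩ := e.exists_image_comp_eq hf hK
  have hpf : f p ∈ f '' e.comp (f ⁻¹' K) :=
    mem_image_of_mem f (e.antitone _ _ (hcompact hf hK) (hcompact hf hL)
      (preimage_mono (hKL.trans interior_subset)) hp)
  have hopen : IsOpen (f '' e.comp (f ⁻¹' K)) := by
    rw [hy]
    exact hK.isClosed.isOpen_compl.connectedComponentIn
  have hev : ∀ᶠ g : C(Y, Y) in 𝓝[HomeoSet Y] f, g p ∈ f '' e.comp (f ⁻¹' K) :=
    ((continuous_eval_const (F := C(Y, Y)) p).continuousAt.eventually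
      (hopen.mem_nhds hpf)).filter_mono nhdsWithin_le_nhds
  filter_upwards [hev, eventually_preimage_subset_preimage hf hK hL hKL, self_mem_nhdsWithin]
    with g hgp hgK hg
  have hgp' : g p ∈ g '' e.comp (g ⁻¹' K) :=
    mem_image_of_mem g (e.antitone _ _ (hcompact hg hK) (hcompact hf hL) hgK hp)
  obtain ⟨z, hz⟩ := e.exists_image_comp_eq hg hK
  rw [hy] at hgp ⊢
  rw [hz] at hgp' ⊢
  rw [connectedComponentIn_eq hgp, connectedComponentIn_eq hgp']

end SpaceEnd

theorem stmt10 {Y : Type*} [TopologicalSpace Y] [ConnectedSpace Y]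
    [LocallyConnectedSpace Y] [LocallyCompactSpace Y]
    [SeparableSpace Y] [MetrizableSpace Y]
    (h : C(Y, Y)) (hh : h ∈ HomeoIdComp Y) (e : SpaceEnd Y) :
    ∀ K : Set Y, IsCompact K → h '' e.comp (h ⁻¹' K) = e.comp K := by
  intro K hK
  have hsub : HomeoIdComp Y ⊆ HomeoSet Y := connectedComponentIn_subset _ _
  have hid : ContinuousMap.id Y ∈ HomeoIdComp Y :=
    mem_connectedComponentIn (Homeomorph.refl Y).isHomeomorph
  have hpre : IsPreconnected (HomeoIdComp Y) := isPreconnected_connectedComponentIn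
  have key := hpre.induction₂
    (fun f g : C(Y, Y) => f '' e.comp (f ⁻¹' K) = g '' e.comp (g ⁻¹' K))
    (fun f hf => (e.eventually_image_comp_eq (hsub hf) hK).filter_mono (nhdsWithin_mono f hsub))
    (fun _ _ _ _ _ _ h₁ h₂ => h₁.trans h₂) (fun _ _ _ _ h₁ => h₁.symm) hh hid
  simpa using key
end

section
/- Let Y be a locally connected, locally compact, separable metrizable space, X a closed subset of Y, and h ∈ 𝓗_X(Y)₀, the connected component of the identity in the space 𝓗_X(Y) of homeomorphisms of Y fixing X pointwise, with the compact-open topology. Then h(C) = C for every connected component C of Y ∖ X. -/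
open TopologicalSpace

/-- The set of homeomorphisms of `M` fixing `X` pointwise, as a subset of `C(M, M)`. -/
def HomeoFixSet (M : Type*) [TopologicalSpace M] (X : Set M) : Set C(M, M) :=
  {f | IsHomeomorph f ∧ ∀ x ∈ X, f x = x}

/-- The identity component `𝓗_X(M)₀`. -/
def HomeoFixIdComp (M : Type*) [TopologicalSpace M] (X : Set M) : Set C(M, M) :=
  connectedComponentIn (HomeoFixSet M X) (ContinuousMap.id M)

/-- A homeomorphism fixing `X` pointwise maps the complement of `X` into itself. -/
theorem HomeoFixSet.apply_notMem {M : Type*} [TopologicalSpace M] {X : Set M} {f : C(M, M)}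
    (hf : f ∈ HomeoFixSet M X) {y : M} (hy : y ∉ X) : f y ∉ X := fun hfy =>
  hy (hf.1.injective (hf.2 _ hfy) ▸ hfy)

/-- Elements of the identity component move each point of `Xᶜ` within its component. -/
theorem HomeoFixIdComp.apply_mem_connectedComponentIn {M : Type*} [TopologicalSpace M]
    {X : Set M} {f : C(M, M)} (hf : f ∈ HomeoFixIdComp M X) {y : M} (hy : y ∉ X) :
    f y ∈ connectedComponentIn Xᶜ y := by
  have hid : ContinuousMap.id M ∈ HomeoFixSet M X :=
    ⟨(Homeomorph.refl M).isHomeomorph, fun _ _ => rfl⟩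
  have hconn : IsPreconnected ((fun g : C(M, M) => g y) '' HomeoFixIdComp M X) :=
    isPreconnected_connectedComponentIn.image _
      (continuous_eval_const y).continuousOn
  refine hconn.subset_connectedComponentIn
    ⟨ContinuousMap.id M, mem_connectedComponentIn hid, rfl⟩ ?_ ⟨f, hf, rfl⟩
  rintro _ ⟨g, hg, rfl⟩
  exact HomeoFixSet.apply_notMem (connectedComponentIn_subset _ _ hg) hy

theorem stmt11 {Y : Type*} [TopologicalSpace Y] [LocallyConnectedSpace Y]
    [LocallyCompactSpace Y] [SeparableSpace Y] [MetrizableSpace Y]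
    (X : Set Y) (hX : IsClosed X)
    (h : C(Y, Y)) (hh : h ∈ HomeoFixIdComp Y X) :
    ∀ C : Set Y, (∃ x ∈ Xᶜ, C = connectedComponentIn Xᶜ x) → h '' C = C := by
  rintro C ⟨x, -, rfl⟩
  have hfix : h ∈ HomeoFixSet Y X := connectedComponentIn_subset _ _ hh
  refine Set.Subset.antisymm ?_ fun z hz => ?_
  · rintro _ ⟨y, hy, rfl⟩
    rw [connectedComponentIn_eq hy]
    exact HomeoFixIdComp.apply_mem_connectedComponentIn hh (connectedComponentIn_subset _ _ hy)
  · obtain ⟨y, rfl⟩ := hfix.1.surjective z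
    have hy : y ∉ X := fun hyX =>
      connectedComponentIn_subset _ _ hz ((hfix.2 y hyX).symm ▸ hyX)
    refine ⟨y, ?_, rfl⟩
    rw [connectedComponentIn_eq hz,
      ← connectedComponentIn_eq (HomeoFixIdComp.apply_mem_connectedComponentIn hh hy)]
    exact mem_connectedComponentIn hy
end

section
/- Let n ≥ 1, let Q = [0,1]ⁿ ⊆ ℝⁿ with the subspace topology, and let ∂Q = Q ∖ (0,1)ⁿ. Let μ and ν be finite Borel measures on Q such that each gives measure zero to every singleton, gives positive measure to every nonempty relatively open subset of Q, μ(∂Q) = ν(∂Q) = 0, and μ(Q) = ν(Q). Then there exists a homeomorphism h : Q → Q with h(x) = x for all x ∈ ∂Q and h_*μ = ν. -/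
open MeasureTheory

/-- The unit cube `Q = [0,1]ⁿ ⊆ ℝⁿ`. -/
def unitCube (n : ℕ) : Set (Fin n → ℝ) := Set.Icc 0 1

/-- The boundary `∂Q = Q ∖ (0,1)ⁿ`, as a subset of the cube. -/
def cubeBoundary (n : ℕ) : Set ↥(unitCube n) :=
  {x | ¬ ∀ i : Fin n, 0 < (x : Fin n → ℝ) i ∧ (x : Fin n → ℝ) i < 1}

namespace OxtobyUlam

open Set Filter Topology

/-! ### Piecewise linear homeomorphisms of the line -/

/-- The piecewise linear map of `ℝ` which sends `p` to `q`, is affine on `[lo, p]` and on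
`[p, hi]`, and is the identity outside `[lo, hi]`. -/
noncomputable def stretch (lo hi p q z : ℝ) : ℝ :=
  z + max 0 (min ((z - lo) / (p - lo)) ((hi - z) / (hi - p))) * (q - p)

section stretch

variable {lo hi p q z : ℝ}

lemma stretch_self : stretch lo hi p p z = z := by simp [stretch]

lemma stretch_of_le_lo (hp : lo < p) (hz : z ≤ lo) : stretch lo hi p q z = z := by
  have h : min ((z - lo) / (p - lo)) ((hi - z) / (hi - p)) ≤ 0 :=
    (min_le_left _ _).trans (div_nonpos_of_nonpos_of_nonneg (by linarith) (by linarith))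
  simp [stretch, max_eq_left h]

lemma stretch_of_hi_le (hp' : p < hi) (hz : hi ≤ z) : stretch lo hi p q z = z := by
  have h : min ((z - lo) / (p - lo)) ((hi - z) / (hi - p)) ≤ 0 :=
    (min_le_right _ _).trans (div_nonpos_of_nonpos_of_nonneg (by linarith) (by linarith))
  simp [stretch, max_eq_left h]

lemma stretch_of_mem_left (hp : lo < p) (hp' : p < hi) (hz : lo ≤ z) (hz' : z ≤ p) :
    stretch lo hi p q z = lo + (z - lo) * ((q - lo) / (p - lo)) := by
  have h1 : (z - lo) / (p - lo) ≤ 1 := (div_le_one (by linarith)).2 (by linarith)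
  have h2 : 1 ≤ (hi - z) / (hi - p) := (one_le_div (by linarith)).2 (by linarith)
  have h3 : 0 ≤ (z - lo) / (p - lo) := div_nonneg (by linarith) (by linarith)
  have h4 : p - lo ≠ 0 := by linarith
  rw [stretch, min_eq_left (h1.trans h2), max_eq_right h3]
  field_simp
  ring

lemma stretch_of_mem_right (hp : lo < p) (hp' : p < hi) (hz : p ≤ z) (hz' : z ≤ hi) :
    stretch lo hi p q z = hi - (hi - z) * ((hi - q) / (hi - p)) := by
  have h1 : 1 ≤ (z - lo) / (p - lo) := (one_le_div (by linarith)).2 (by linarith)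
  have h2 : (hi - z) / (hi - p) ≤ 1 := (div_le_one (by linarith)).2 (by linarith)
  have h3 : 0 ≤ (hi - z) / (hi - p) := div_nonneg (by linarith) (by linarith)
  have h4 : hi - p ≠ 0 := by linarith
  rw [stretch, min_eq_right (h2.trans h1), max_eq_right h3]
  field_simp
  ring

lemma stretch_lt (hp : lo < p) (hp' : p < hi) (hq : lo < q) (hz : z < p) :
    stretch lo hi p q z < q := by
  rcases le_total z lo with h | h
  · rw [stretch_of_le_lo hp h]; linarith
  · rw [stretch_of_mem_left hp hp' h hz.le]
    have h1 : 0 < (q - lo) / (p - lo) := div_pos (by linarith) (by linarith)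
    have h2 : (z - lo) * ((q - lo) / (p - lo)) < (p - lo) * ((q - lo) / (p - lo)) :=
      mul_lt_mul_of_pos_right (by linarith) h1
    rw [mul_div_cancel₀ _ (by linarith : p - lo ≠ 0)] at h2
    linarith

lemma lt_stretch (hp : lo < p) (hp' : p < hi) (hq : q < hi) (hz : p < z) :
    q < stretch lo hi p q z := by
  rcases le_total hi z with h | h
  · rw [stretch_of_hi_le hp' h]; linarith
  · rw [stretch_of_mem_right hp hp' hz.le h]
    have h1 : 0 < (hi - q) / (hi - p) := div_pos (by linarith) (by linarith)
    have h2 : (hi - z) * ((hi - q) / (hi - p)) < (hi - p) * ((hi - q) / (hi - p)) :=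
      mul_lt_mul_of_pos_right (by linarith) h1
    rw [mul_div_cancel₀ _ (by linarith : hi - p ≠ 0)] at h2
    linarith

lemma stretch_apply_self (hp : lo < p) (hp' : p < hi) : stretch lo hi p q p = q := by
  have h4 : p - lo ≠ 0 := by linarith
  rw [stretch_of_mem_left hp hp' hp.le le_rfl, mul_div_cancel₀ _ h4]
  ring

lemma stretch_lt_iff (hp : lo < p) (hp' : p < hi) (hq : lo < q) (hq' : q < hi) :
    stretch lo hi p q z < q ↔ z < p := by
  refine ⟨fun h => ?_, stretch_lt hp hp' hq⟩
  by_contra! hz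
  rcases hz.eq_or_lt with rfl | hz
  · rw [stretch_apply_self hp hp'] at h; exact lt_irrefl _ h
  · exact lt_asymm h (lt_stretch hp hp' hq' hz)

lemma stretch_eq_iff (hp : lo < p) (hp' : p < hi) (hq : lo < q) (hq' : q < hi) :
    stretch lo hi p q z = q ↔ z = p := by
  refine ⟨fun h => ?_, fun h => by rw [h, stretch_apply_self hp hp']⟩
  rcases lt_trichotomy z p with hz | hz | hz
  · exact absurd h (stretch_lt hp hp' hq hz).ne
  · exact hz
  · exact absurd h (lt_stretch hp hp' hq' hz).ne'

lemma stretch_stretch (hp : lo < p) (hp' : p < hi) (hq : lo < q) (hq' : q < hi) :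
    stretch lo hi q p (stretch lo hi p q z) = z := by
  have hpl : p - lo ≠ 0 := by linarith
  have hql : q - lo ≠ 0 := by linarith
  have hph : hi - p ≠ 0 := by linarith
  have hqh : hi - q ≠ 0 := by linarith
  rcases le_total z lo with h | h
  · rw [stretch_of_le_lo hp h, stretch_of_le_lo hq h]
  rcases le_total hi z with h' | h'
  · rw [stretch_of_hi_le hp' h', stretch_of_hi_le hq' h']
  rcases le_total z p with hz | hz
  · have h1 : stretch lo hi p q z ≤ q := by
      rcases hz.eq_or_lt with rfl | hz
      · exact (stretch_apply_self hp hp').le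
      · exact (stretch_lt hp hp' hq hz).le
    rw [stretch_of_mem_left hp hp' h hz] at h1 ⊢
    rw [stretch_of_mem_left hq hq' (le_add_of_nonneg_right (mul_nonneg (by linarith)
      (div_nonneg (by linarith) (by linarith)))) h1]
    field_simp
    ring
  · have h1 : q ≤ stretch lo hi p q z := by
      rcases hz.eq_or_lt with rfl | hz
      · exact (stretch_apply_self hp hp').ge
      · exact (lt_stretch hp hp' hq' hz).le
    rw [stretch_of_mem_right hp hp' hz h'] at h1 ⊢
    rw [stretch_of_mem_right hq hq' h1 (sub_le_self _ (mul_nonneg (by linarith)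
      (div_nonneg (by linarith) (by linarith))))]
    field_simp
    ring

end stretch

/-! ### Shears of a box along a coordinate direction -/

variable {n : ℕ}

/-- The homeomorphism of `ℝⁿ` which moves points along the `i`-th coordinate and sends the
hyperplane `x i = c` to the graph `x i = v x` of a function not depending on `x i`. -/
noncomputable def shear (i : Fin n) {lo hi c : ℝ} (hlo : lo < c) (hhi : c < hi)
    (v : (Fin n → ℝ) → ℝ) (hv : Continuous v) (hvu : ∀ x z, v (Function.update x i z) = v x)
    (hv_lo : ∀ x, lo < v x) (hv_hi : ∀ x, v x < hi) : (Fin n → ℝ) ≃ₜ (Fin n → ℝ) where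
  toFun x := Function.update x i (stretch lo hi c (v x) (x i))
  invFun x := Function.update x i (stretch lo hi (v x) c (x i))
  left_inv x := by
    simp [hvu, stretch_stretch hlo hhi (hv_lo x) (hv_hi x)]
  right_inv x := by
    simp [hvu, stretch_stretch (hv_lo x) (hv_hi x) hlo hhi]
  continuous_toFun := by
    refine continuous_id.update i ?_
    unfold stretch
    fun_prop
  continuous_invFun := by
    refine continuous_id.update i ?_
    have h1 : ∀ x, v x - lo ≠ 0 := fun x => by have := hv_lo x; linarith
    have h2 : ∀ x, hi - v x ≠ 0 := fun x => by have := hv_hi x; linarith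
    unfold stretch
    fun_prop (disch := assumption)

/-! ### Generic functionals have no atoms -/

lemma volume_setOf_sum_pow_eq_zero {d : Fin n → ℝ} (hd : d ≠ 0) :
    volume {r : ℝ | ∑ j : Fin n, r ^ (j : ℕ) * d j = 0} = 0 := by
  set p : Polynomial ℝ := ∑ j : Fin n, Polynomial.C (d j) * Polynomial.X ^ (j : ℕ) with hp
  have hcoeff : ∀ j : Fin n, p.coeff j = d j := by
    intro j
    simp [hp, Polynomial.finsetSum_coeff, Polynomial.coeff_X_pow, Fin.val_inj]
  have hp0 : p ≠ 0 := by
    rintro h0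
    exact hd (funext fun j => by rw [← hcoeff, h0]; simp)
  refine Set.Finite.measure_zero ((Polynomial.finite_setOfPred_isRoot hp0).subset ?_) _
  intro r hr
  simp only [mem_ofPred_eq, Polynomial.IsRoot.def] at hr ⊢
  rw [← hr, hp, Polynomial.eval_finsetSum]
  exact Finset.sum_congr rfl fun j _ => by
    rw [Polynomial.eval_mul, Polynomial.eval_C, Polynomial.eval_pow, Polynomial.eval_X, mul_comm]

/-- If `w` is injective on a set of full measure for an atomless measure `β`, then for almost every
`r` the function `∑ j, r ^ j * w x j` has an atomless distribution. -/
lemma ae_forall_measure_level_eq_zero {X : Type*} [MeasurableSpace X] [MeasurableEq X]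
    {β : Measure X} [IsFiniteMeasure β] (hβ : ∀ x, β {x} = 0) {w : X → Fin n → ℝ}
    (hw : Measurable w) {S : Set X} (hS : MeasurableSet S) (hinj : InjOn w S) :
    ∀ᵐ r : ℝ, ∀ t : ℝ, β (S ∩ {x | ∑ j : Fin n, r ^ (j : ℕ) * w x j = t}) = 0 := by
  set γ := β.restrict S with hγ
  set A : Set (ℝ × (X × X)) :=
    {p | ∑ j : Fin n, p.1 ^ (j : ℕ) * w p.2.1 j = ∑ j : Fin n, p.1 ^ (j : ℕ) * w p.2.2 j} with hA
  have hwj : ∀ j, Measurable fun x => w x j := fun j => (measurable_pi_apply j).comp hw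
  have hAm : MeasurableSet A := by
    refine measurableSet_eq_fun ?_ ?_ <;>
      exact Finset.measurable_fun_sum _ fun j _ => by have := hwj j; fun_prop
  have hdiag : ∀ᵐ p ∂(γ.prod γ), p.1 ≠ p.2 := by
    refine (Measure.ae_prod_iff_ae_ae ?_).2 ?_
    · exact (measurableSet_eq_fun measurable_fst measurable_snd).compl
    · refine Eventually.of_forall fun x => ?_
      have : γ {x} = 0 := le_antisymm ((Measure.restrict_apply_le _ _).trans (hβ x).le) bot_le
      rw [ae_iff]
      convert this using 2
      ext y
      simp [eq_comm]
  have hmem : ∀ᵐ p ∂(γ.prod γ), p.1 ∈ S ∧ p.2 ∈ S := by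
    have : γ.prod γ = (β.prod β).restrict (S ×ˢ S) := by rw [hγ, Measure.prod_restrict]
    rw [this]
    filter_upwards [ae_restrict_mem (hS.prod hS)] with p hp using hp
  have hnull : ∀ᵐ p ∂(γ.prod γ), ∀ᵐ r : ℝ, (r, p) ∉ A := by
    filter_upwards [hdiag, hmem] with p hne hp
    have hd : w p.1 - w p.2 ≠ 0 := fun h => hne (hinj hp.1 hp.2 (sub_eq_zero.1 h))
    rw [ae_iff]
    convert volume_setOf_sum_pow_eq_zero hd using 3 with r
    simp [hA, mul_sub, sub_eq_zero]
  have hswap : ∀ᵐ r : ℝ, ∀ᵐ p ∂(γ.prod γ), (r, p) ∉ A :=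
    (Measure.ae_ae_comm (p := fun r p => (r, p) ∉ A) hAm.compl).2 hnull
  filter_upwards [hswap] with r hr t
  have hsub : (S ∩ {x | ∑ j : Fin n, r ^ (j : ℕ) * w x j = t}) ×ˢ
      (S ∩ {x | ∑ j : Fin n, r ^ (j : ℕ) * w x j = t}) ⊆ {p | ¬ (r, p) ∉ A} := by
    rintro ⟨x, y⟩ ⟨⟨_, hx⟩, _, hy⟩
    simp only [mem_ofPred_eq] at hx hy
    simp [hA, hx, hy]
  have h0 := measure_mono_null hsub (ae_iff.1 hr)
  rw [Measure.prod_prod] at h0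
  have h1 := mul_self_eq_zero.1 h0
  rwa [hγ, Measure.restrict_apply' hS, inter_right_comm, inter_self] at h1

/-- A finite measure on the line without atoms takes all intermediate values on half-lines. -/
lemma exists_measure_Iio_eq {κ : Measure ℝ} [IsFiniteMeasure κ] (hκ : ∀ t, κ {t} = 0)
    {s : ENNReal} (hs : 0 < s) (hs' : s < κ univ) : ∃ t, κ (Iio t) = s := by
  set A : Set ℝ := {t | κ (Iio t) ≤ s} with hA
  have hne : A.Nonempty := by
    have h : Tendsto (fun t => κ (Iic t)) atBot (𝓝 (κ (⋂ t, Iic t))) :=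
      tendsto_measure_iInter_atBot (fun _ => measurableSet_Iic.nullMeasurableSet) monotone_Iic
        ⟨0, measure_ne_top _ _⟩
    rw [iInter_Iic_eq_empty_iff.2 (by simp), measure_empty] at h
    obtain ⟨t, ht⟩ := (h.eventually_lt_const hs).exists
    exact ⟨t, (measure_mono Iio_subset_Iic_self).trans ht.le⟩
  have hbdd : BddAbove A := by
    obtain ⟨t, ht⟩ := ((tendsto_measure_Iic_atTop κ).eventually_const_lt hs').exists
    refine ⟨t, fun r hr => ?_⟩
    by_contra! h
    exact (ht.trans_le (measure_mono (Iic_subset_Iio.2 h))).not_ge hr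
  refine ⟨sSup A, le_antisymm ?_ ?_⟩
  · obtain ⟨q, hq, hqt, hqA⟩ := exists_seq_tendsto_sSup hne hbdd
    have hU : Iio (sSup A) = ⋃ k, Iio (q k) := by
      ext x
      simp only [mem_Iio, mem_iUnion]
      exact ⟨fun hx => (hqt.eventually_const_lt hx).exists,
        fun ⟨k, hk⟩ => hk.trans_le (le_csSup hbdd (hqA k))⟩
    rw [hU, Monotone.measure_iUnion fun i j hij => Iio_subset_Iio (hq hij)]
    exact iSup_le fun k => hqA k
  · have hlim : Tendsto (fun k : ℕ => κ (Iio (sSup A + 1 / ((k : ℝ) + 1)))) atTop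
        (𝓝 (κ (⋂ k : ℕ, Iio (sSup A + 1 / ((k : ℝ) + 1))))) := by
      refine tendsto_measure_iInter_atTop (fun k => measurableSet_Iio.nullMeasurableSet) ?_
        ⟨0, measure_ne_top _ _⟩
      intro i j hij
      exact Iio_subset_Iio (by gcongr)
    have hge : s ≤ κ (⋂ k : ℕ, Iio (sSup A + 1 / ((k : ℝ) + 1))) := by
      refine ge_of_tendsto' hlim fun k => ?_
      by_contra! h
      have := le_csSup hbdd (show sSup A + 1 / ((k : ℝ) + 1) ∈ A from h.le)
      have hk : 0 < 1 / ((k : ℝ) + 1) := by positivity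
      linarith
    have hsub : (⋂ k : ℕ, Iio (sSup A + 1 / ((k : ℝ) + 1))) ⊆ Iio (sSup A) ∪ {sSup A} := by
      intro x hx
      rw [mem_iInter] at hx
      rw [Iio_union_right]
      refine mem_Iic.2 (le_of_forall_pos_lt_add fun ε hε => ?_)
      obtain ⟨k, hk⟩ := exists_nat_one_div_lt hε
      exact (hx k).trans (by linarith)
    calc s ≤ _ := hge.trans (measure_mono hsub)
      _ ≤ κ (Iio (sSup A)) + κ {sSup A} := measure_union_le _ _
      _ = κ (Iio (sSup A)) := by rw [hκ, add_zero]

/-! ### Homeomorphisms supported in a set -/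

section supported

variable {X : Type*} [TopologicalSpace X] {g : X ≃ₜ X} {U A : Set X}

lemma symm_apply_of_notMem (hg : ∀ x ∉ U, g x = x) {x : X} (hx : x ∉ U) : g.symm x = x := by
  rw [Homeomorph.symm_apply_eq, hg x hx]

lemma symm_apply_mem_iff (hg : ∀ x ∉ U, g x = x) {x : X} : g.symm x ∈ U ↔ x ∈ U := by
  refine ⟨fun h => ?_, fun h => ?_⟩
  · by_contra hx
    exact hx (symm_apply_of_notMem hg hx ▸ h)
  · by_contra hx
    have := hg _ hx
    rw [Homeomorph.apply_symm_apply] at this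
    exact hx (this ▸ h)

lemma symm_preimage_eq_of_subset (hg : ∀ x ∉ U, g x = x) (h : U ⊆ A) : g.symm ⁻¹' A = A := by
  ext x
  by_cases hx : x ∈ U
  · simp [h hx, h ((symm_apply_mem_iff hg).2 hx)]
  · simp [symm_apply_of_notMem hg hx]

lemma symm_preimage_eq_of_disjoint (hg : ∀ x ∉ U, g x = x) (h : Disjoint A U) :
    g.symm ⁻¹' A = A := by
  have := symm_preimage_eq_of_subset hg (subset_compl_iff_disjoint_left.2 h)
  rw [preimage_compl, compl_inj_iff] at this
  exact this

end supported

/-! ### Dividing a box in a prescribed proportion -/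

/-- The open box with corners `C.1` and `C.2`. -/
def openBox (C : (Fin n → ℝ) × (Fin n → ℝ)) : Set (Fin n → ℝ) :=
  {x | ∀ i, C.1 i < x i ∧ x i < C.2 i}

lemma openBox_eq_pi (C : (Fin n → ℝ) × (Fin n → ℝ)) :
    openBox C = univ.pi fun i => Ioo (C.1 i) (C.2 i) := by
  ext x; simp [openBox]

lemma isOpen_openBox (C : (Fin n → ℝ) × (Fin n → ℝ)) : IsOpen (openBox C) := by
  rw [openBox_eq_pi]
  exact isOpen_set_pi finite_univ fun i _ => isOpen_Ioo

lemma closure_openBox {C : (Fin n → ℝ) × (Fin n → ℝ)} (hC : ∀ i, C.1 i < C.2 i) :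
    closure (openBox C) = Icc C.1 C.2 := by
  rw [openBox_eq_pi, closure_pi_set, ← pi_univ_Icc]
  exact congrArg _ (funext fun i => closure_Ioo (hC i).ne)

lemma openBox_subset_Icc (C : (Fin n → ℝ) × (Fin n → ℝ)) : openBox C ⊆ Icc C.1 C.2 :=
  fun _ hx => ⟨fun i => (hx i).1.le, fun i => (hx i).2.le⟩

lemma openBox_nonempty {C : (Fin n → ℝ) × (Fin n → ℝ)} (hC : ∀ i, C.1 i < C.2 i) :
    (openBox C).Nonempty := by
  choose x hx using fun i => exists_between (hC i)
  exact ⟨x, hx⟩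

/-- An increasing parametrization of the interval `(lo, hi)` by `ℝ` with value `c` at `0`. -/
noncomputable def sigmoid (lo hi c s : ℝ) : ℝ :=
  hi - (hi - lo) * (hi - c) / ((hi - c) + (c - lo) * Real.exp s)

section sigmoid

variable {lo hi c : ℝ}

lemma sigmoid_denom_pos (hlo : lo < c) (hhi : c < hi) (s : ℝ) :
    0 < (hi - c) + (c - lo) * Real.exp s :=
  add_pos (sub_pos.2 hhi) (mul_pos (sub_pos.2 hlo) (Real.exp_pos s))

lemma continuous_sigmoid (hlo : lo < c) (hhi : c < hi) : Continuous (sigmoid lo hi c) := by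
  have h := fun s => (sigmoid_denom_pos hlo hhi s).ne'
  unfold sigmoid
  fun_prop (disch := assumption)

lemma strictMono_sigmoid (hlo : lo < c) (hhi : c < hi) : StrictMono (sigmoid lo hi c) := by
  intro s t hst
  have h1 : 0 < (hi - lo) * (hi - c) := mul_pos (by linarith) (by linarith)
  have h2 : (hi - c) + (c - lo) * Real.exp s < (hi - c) + (c - lo) * Real.exp t := by
    have := mul_lt_mul_of_pos_left (Real.exp_lt_exp.2 hst) (sub_pos.2 hlo)
    linarith
  have := div_lt_div_of_pos_left h1 (sigmoid_denom_pos hlo hhi s) h2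
  unfold sigmoid
  linarith

lemma sigmoid_zero (hlo : lo < c) (hhi : c < hi) : sigmoid lo hi c 0 = c := by
  have h : hi - lo ≠ 0 := by linarith
  have h' : (hi - c) + (c - lo) * Real.exp 0 = hi - lo := by rw [Real.exp_zero]; ring
  rw [sigmoid, h', mul_div_cancel_left₀ _ h]
  ring

lemma sigmoid_lt (hlo : lo < c) (hhi : c < hi) (s : ℝ) : sigmoid lo hi c s < hi := by
  have := div_pos (mul_pos (show 0 < hi - lo by linarith) (sub_pos.2 hhi))
    (sigmoid_denom_pos hlo hhi s)
  unfold sigmoid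
  linarith

lemma lt_sigmoid (hlo : lo < c) (hhi : c < hi) (s : ℝ) : lo < sigmoid lo hi c s := by
  have : (hi - lo) * (hi - c) / ((hi - c) + (c - lo) * Real.exp s) < hi - lo := by
    rw [div_lt_iff₀ (sigmoid_denom_pos hlo hhi s)]
    refine mul_lt_mul_of_pos_left ?_ (by linarith)
    have := mul_pos (sub_pos.2 hlo) (Real.exp_pos s)
    linarith
  unfold sigmoid
  linarith

lemma sigmoid_log (hlo : lo < c) (hhi : c < hi) {z : ℝ} (hz : lo < z) (hz' : z < hi) :
    sigmoid lo hi c (Real.log ((hi - c) * (z - lo) / ((hi - z) * (c - lo)))) = z := by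
  have h1 : 0 < c - lo := by linarith
  have h2 : 0 < hi - c := by linarith
  have h3 : 0 < z - lo := by linarith
  have h4 : 0 < hi - z := by linarith
  have h5 : hi - lo ≠ 0 := by linarith
  have h6 : (hi - c) + (c - lo) * ((hi - c) * (z - lo) / ((hi - z) * (c - lo))) =
      (hi - lo) * (hi - c) / (hi - z) := by
    field_simp
    ring
  rw [sigmoid, Real.exp_log (by positivity), h6]
  field_simp
  ring

end sigmoid

/-- A box can be divided by the image of a hyperplane section in any prescribed proportion, using
a homeomorphism supported in the box. -/
lemma exists_homeomorph_measure_eq {C : (Fin n → ℝ) × (Fin n → ℝ)} (i : Fin n) {c : ℝ}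
    (hlo : C.1 i < c) (hhi : c < C.2 i) {β : Measure (Fin n → ℝ)} [IsFiniteMeasure β]
    (hβ : ∀ x, β {x} = 0) {s : ENNReal} (hs : 0 < s) (hs' : s < β (openBox C)) :
    ∃ g : (Fin n → ℝ) ≃ₜ (Fin n → ℝ), (∀ x ∉ openBox C, g x = x) ∧
      β (g.symm ⁻¹' (openBox C ∩ {x | x i < c})) = s ∧
      β (g.symm ⁻¹' (openBox C ∩ {x | x i = c})) = 0 := by
  set ρ : (Fin n → ℝ) → ℝ :=
    fun x => ∏ j ∈ Finset.univ.erase i, max 0 (x j - C.1 j) * max 0 (C.2 j - x j) with hρ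
  set ψ : ℝ → ℝ := fun z => Real.log ((C.2 i - c) * (z - C.1 i) / ((C.2 i - z) * (c - C.1 i)))
  have hψ : ∀ {x}, x ∈ openBox C → sigmoid (C.1 i) (C.2 i) c (ψ (x i)) = x i :=
    fun hx => sigmoid_log hlo hhi (hx i).1 (hx i).2
  have hρc : Continuous ρ := by fun_prop
  have hρpos : ∀ {x}, x ∈ openBox C → 0 < ρ x := fun hx => Finset.prod_pos fun j _ =>
    mul_pos (lt_max_of_lt_right (sub_pos.2 (hx j).1)) (lt_max_of_lt_right (sub_pos.2 (hx j).2))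
  have hρu : ∀ x y : Fin n → ℝ, (∀ j ≠ i, x j = y j) → ρ x = ρ y := fun x y h =>
    Finset.prod_congr rfl fun j hj => by rw [h j (Finset.ne_of_mem_erase hj)]
  set w : (Fin n → ℝ) → Fin n → ℝ := fun x => Function.update x i (ψ (x i) / ρ x) with hw
  have hwm : Measurable w := by
    refine measurable_pi_iff.2 fun j => ?_
    by_cases hj : j = i
    · subst hj
      have := hρc.measurable
      simp only [hw, Function.update_self, ψ]
      fun_prop
    · simp only [hw, Function.update_of_ne hj]
      fun_prop
  have hinj : InjOn w (openBox C) := by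
    intro x hx y hy hxy
    have h1 : ∀ j ≠ i, x j = y j := fun j hj => by
      simpa [hw, Function.update_of_ne hj] using congrFun hxy j
    have h2 : ψ (x i) / ρ x = ψ (y i) / ρ y := by simpa [hw] using congrFun hxy i
    rw [← hρu x y h1, div_left_inj' (hρpos hx).ne'] at h2
    funext j
    by_cases hj : j = i
    · subst hj
      rw [← hψ hx, h2, hψ hy]
    · exact h1 j hj
  obtain ⟨r, hr, hatom⟩ := ((frequently_ae_mem_iff.2 (by simp :
    (volume : Measure ℝ) (Ioo 0 1) ≠ 0)).and_eventually (ae_forall_measure_level_eq_zero hβ hwm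
      (isOpen_openBox C).measurableSet hinj)).exists
  have hri : 0 < r ^ (i : ℕ) := pow_pos hr.1 _
  set T : (Fin n → ℝ) → ℝ := fun x => ∑ j : Fin n, r ^ (j : ℕ) * w x j with hT
  have hTm : Measurable T := Finset.measurable_fun_sum _ fun j _ =>
    ((measurable_pi_apply j).comp hwm).const_mul _
  have hTi : ∀ x, T x = r ^ (i : ℕ) * (ψ (x i) / ρ x) +
      ∑ j ∈ Finset.univ.erase i, r ^ (j : ℕ) * x j := by
    intro x
    simp only [hT]
    rw [← Finset.add_sum_erase _ _ (Finset.mem_univ i)]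
    congr 1
    · simp [hw]
    · exact Finset.sum_congr rfl fun j hj => by
        simp [hw, Function.update_of_ne (Finset.ne_of_mem_erase hj)]
  set κ : Measure ℝ := (β.restrict (openBox C)).map T
  have hκ : ∀ A : Set ℝ, MeasurableSet A → κ A = β (openBox C ∩ T ⁻¹' A) := fun A hA => by
    rw [Measure.map_apply hTm hA, Measure.restrict_apply (hTm hA), inter_comm]
  obtain ⟨t, ht⟩ : ∃ t, κ (Iio t) = s := by
    refine exists_measure_Iio_eq (fun t => ?_) hs ?_
    · rw [hκ _ (measurableSet_singleton t)]
      exact hatom t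
    · rwa [hκ _ MeasurableSet.univ, preimage_univ, inter_univ]
  set v : (Fin n → ℝ) → ℝ := fun x => sigmoid (C.1 i) (C.2 i) c
    (ρ x * ((t - ∑ j ∈ Finset.univ.erase i, r ^ (j : ℕ) * x j) / r ^ (i : ℕ))) with hv
  have hvc : Continuous v := (continuous_sigmoid hlo hhi).comp (by fun_prop)
  have hvu : ∀ x z, v (Function.update x i z) = v x := by
    intro x z
    have h1 : ρ (Function.update x i z) = ρ x :=
      hρu _ _ fun j hj => Function.update_of_ne hj _ _
    have h2 : ∑ j ∈ Finset.univ.erase i, r ^ (j : ℕ) * Function.update x i z j =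
        ∑ j ∈ Finset.univ.erase i, r ^ (j : ℕ) * x j :=
      Finset.sum_congr rfl fun j hj => by rw [Function.update_of_ne (Finset.ne_of_mem_erase hj)]
    simp only [hv, h1, h2]
  have hv_lo : ∀ x, C.1 i < v x := fun x => lt_sigmoid hlo hhi _
  have hv_hi : ∀ x, v x < C.2 i := fun x => sigmoid_lt hlo hhi _
  have hTψ : ∀ {x}, x ∈ openBox C → T x - t = r ^ (i : ℕ) / ρ x * (ψ (x i) -
      ρ x * ((t - ∑ j ∈ Finset.univ.erase i, r ^ (j : ℕ) * x j) / r ^ (i : ℕ))) := by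
    intro x hx
    have := (hρpos hx).ne'
    rw [hTi]
    field_simp
    ring
  have hTlt : ∀ {x}, x ∈ openBox C → (x i < v x ↔ T x < t) := by
    intro x hx
    have hpos := div_pos hri (hρpos hx)
    rw [← hψ hx, (strictMono_sigmoid hlo hhi).lt_iff_lt, ← sub_neg (a := T x), hTψ hx,
      ← smul_eq_mul (r ^ (i : ℕ) / ρ x), smul_neg_iff_of_pos_left hpos, sub_neg]
  have hTeq : ∀ {x}, x ∈ openBox C → (x i = v x ↔ T x = t) := by
    intro x hx
    have hpos := div_pos hri (hρpos hx)
    rw [← hψ hx, (strictMono_sigmoid hlo hhi).injective.eq_iff, ← sub_eq_zero (a := T x), hTψ hx,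
      mul_eq_zero_iff_left hpos.ne', sub_eq_zero]
  set g := shear i hlo hhi v hvc hvu hv_lo hv_hi with hg
  have hsupp : ∀ x ∉ openBox C, g x = x := by
    intro x hx
    have hgx : g x = Function.update x i (stretch (C.1 i) (C.2 i) c (v x) (x i)) := rfl
    simp only [openBox, mem_ofPred_eq, not_forall] at hx
    obtain ⟨j, hj⟩ := hx
    rw [hgx, Function.update_eq_self_iff]
    by_cases hji : j = i
    · subst hji
      rcases le_or_gt (x j) (C.1 j) with h | h
      · exact stretch_of_le_lo hlo h
      · exact stretch_of_hi_le hhi (not_lt.1 fun h' => hj ⟨h, h'⟩)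
    · have hρ0 : ρ x = 0 := by
        refine Finset.prod_eq_zero (Finset.mem_erase.2 ⟨hji, Finset.mem_univ j⟩) ?_
        rcases le_or_gt (x j) (C.1 j) with h | h
        · rw [max_eq_left (sub_nonpos.2 h), zero_mul]
        · rw [max_eq_left (sub_nonpos.2 (not_lt.1 fun h' => hj ⟨h, h'⟩)), mul_zero]
      have hvx : v x = c := by simp only [hv, hρ0, zero_mul, sigmoid_zero hlo hhi]
      rw [hvx, stretch_self]
  have hgi : ∀ x, g.symm x i = stretch (C.1 i) (C.2 i) (v x) c (x i) := fun x =>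
    Function.update_self _ _ _
  refine ⟨g, hsupp, ?_, ?_⟩
  · rw [← ht, hκ _ measurableSet_Iio]
    congr 1
    ext x
    simp only [mem_preimage, mem_inter_iff, mem_ofPred_eq, symm_apply_mem_iff hsupp, hgi,
      stretch_lt_iff (hv_lo x) (hv_hi x) hlo hhi, mem_Iio]
    exact and_congr_right hTlt
  · rw [← hatom t]
    congr 1
    ext x
    simp only [mem_preimage, mem_inter_iff, mem_ofPred_eq, symm_apply_mem_iff hsupp, hgi,
      stretch_eq_iff (hv_lo x) (hv_hi x) hlo hhi]
    exact and_congr_right hTeq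

/-! ### Matched partitions into boxes -/

/-- An atomless measure charging every nonempty open subset of the open unit cube. -/
structure IsDiffuse (α : Measure (Fin n → ℝ)) : Prop where
  atomless : ∀ x, α {x} = 0
  pos : ∀ U, IsOpen U → U.Nonempty → U ⊆ openBox (0, 1) → 0 < α U

lemma map_symm_apply (α : Measure (Fin n → ℝ)) (g : (Fin n → ℝ) ≃ₜ (Fin n → ℝ))
    (A : Set (Fin n → ℝ)) : α.map g.symm A = α (g.symm ⁻¹' A) :=
  g.symm.measurableEmbedding.map_apply α A

lemma IsDiffuse.map_symm {α : Measure (Fin n → ℝ)} (hα : IsDiffuse α)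
    {g : (Fin n → ℝ) ≃ₜ (Fin n → ℝ)} (hg : ∀ x ∉ openBox (0, 1), g x = x) :
    IsDiffuse (α.map g.symm) where
  atomless x := by
    rw [map_symm_apply, ← Homeomorph.image_eq_preimage_symm, image_singleton]
    exact hα.atomless _
  pos U hU hne hsub := by
    rw [map_symm_apply]
    refine hα.pos _ (hU.preimage g.symm.continuous) (hne.preimage g.symm.surjective) ?_
    exact (preimage_mono hsub).trans (symm_preimage_eq_of_subset hg subset_rfl).subset

/-- The part of the box `C` below the hyperplane `x i = c`. -/
noncomputable def lowerBox (C : (Fin n → ℝ) × (Fin n → ℝ)) (i : Fin n) (c : ℝ) :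
    (Fin n → ℝ) × (Fin n → ℝ) := (C.1, Function.update C.2 i c)

/-- The part of the box `C` above the hyperplane `x i = c`. -/
noncomputable def upperBox (C : (Fin n → ℝ) × (Fin n → ℝ)) (i : Fin n) (c : ℝ) :
    (Fin n → ℝ) × (Fin n → ℝ) := (Function.update C.1 i c, C.2)

section split

variable {C : (Fin n → ℝ) × (Fin n → ℝ)} {i : Fin n} {c : ℝ}

lemma openBox_lowerBox (hc : c < C.2 i) :
    openBox (lowerBox C i c) = openBox C ∩ {x | x i < c} := by
  ext x
  simp only [openBox, lowerBox, mem_inter_iff, mem_ofPred_eq]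
  refine ⟨fun h => ⟨fun j => ⟨(h j).1, ?_⟩, by simpa using (h i).2⟩, fun h j => ⟨(h.1 j).1, ?_⟩⟩
  · by_cases hj : j = i
    · subst hj; exact (by simpa using (h j).2 : x j < c).trans hc
    · simpa [hj] using (h j).2
  · by_cases hj : j = i
    · subst hj; simpa using h.2
    · simpa [hj] using (h.1 j).2

lemma openBox_upperBox (hc : C.1 i < c) :
    openBox (upperBox C i c) = openBox C ∩ {x | c < x i} := by
  ext x
  simp only [openBox, upperBox, mem_inter_iff, mem_ofPred_eq]
  refine ⟨fun h => ⟨fun j => ⟨?_, (h j).2⟩, by simpa using (h i).1⟩, fun h j => ⟨?_, (h.1 j).2⟩⟩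
  · by_cases hj : j = i
    · subst hj; exact hc.trans (by simpa using (h j).1 : c < x j)
    · simpa [hj] using (h j).1
  · by_cases hj : j = i
    · subst hj; simpa using h.2
    · simpa [hj] using (h.1 j).1

lemma Icc_lowerBox (hc : c < C.2 i) :
    Icc (lowerBox C i c).1 (lowerBox C i c).2 = Icc C.1 C.2 ∩ {x | x i ≤ c} := by
  ext x
  simp only [lowerBox, mem_Icc, mem_inter_iff, mem_ofPred_eq, le_update_iff]
  refine ⟨fun h => ⟨⟨h.1, fun j => ?_⟩, h.2.1⟩, fun h => ⟨h.1.1, h.2, fun j _ => h.1.2 j⟩⟩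
  by_cases hj : j = i
  · subst hj; exact h.2.1.trans hc.le
  · exact h.2.2 j hj

lemma Icc_upperBox (hc : C.1 i < c) :
    Icc (upperBox C i c).1 (upperBox C i c).2 = Icc C.1 C.2 ∩ {x | c ≤ x i} := by
  ext x
  simp only [upperBox, mem_Icc, mem_inter_iff, mem_ofPred_eq, update_le_iff]
  refine ⟨fun h => ⟨⟨fun j => ?_, h.2⟩, h.1.1⟩, fun h => ⟨⟨h.2, fun j _ => h.1.1 j⟩, h.1.2⟩⟩
  by_cases hj : j = i
  · subst hj; exact hc.le.trans h.1.1
  · exact h.1.2 j hj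

lemma Icc_eq_lowerBox_union_upperBox (hc : C.1 i < c) (hc' : c < C.2 i) :
    Icc C.1 C.2 = Icc (lowerBox C i c).1 (lowerBox C i c).2 ∪
      Icc (upperBox C i c).1 (upperBox C i c).2 := by
  rw [Icc_lowerBox hc', Icc_upperBox hc, ← inter_union_distrib_left, eq_comm, inter_eq_left]
  exact fun x _ => le_total (x i) c

lemma lowerBox_lt (hC : ∀ j, C.1 j < C.2 j) (hc : C.1 i < c) (j : Fin n) :
    (lowerBox C i c).1 j < (lowerBox C i c).2 j := by
  by_cases hj : j = i
  · subst hj; simpa [lowerBox] using hc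
  · simpa [lowerBox, hj] using hC j

lemma upperBox_lt (hC : ∀ j, C.1 j < C.2 j) (hc : c < C.2 i) (j : Fin n) :
    (upperBox C i c).1 j < (upperBox C i c).2 j := by
  by_cases hj : j = i
  · subst hj; simpa [upperBox] using hc
  · simpa [upperBox, hj] using hC j

variable {γ : Measure (Fin n → ℝ)}

lemma measure_lowerBox_boundary (hc' : c < C.2 i) (hγ : γ (Icc C.1 C.2 \ openBox C) = 0)
    (hγc : γ (openBox C ∩ {x | x i = c}) = 0) :
    γ (Icc (lowerBox C i c).1 (lowerBox C i c).2 \ openBox (lowerBox C i c)) = 0 := by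
  refine measure_mono_null ?_ (measure_union_null hγ hγc)
  rw [Icc_lowerBox hc', openBox_lowerBox hc']
  rintro x ⟨⟨hx, hxc⟩, hx'⟩
  by_cases hxo : x ∈ openBox C
  · exact Or.inr ⟨hxo, le_antisymm hxc (not_lt.1 fun h => hx' ⟨hxo, h⟩)⟩
  · exact Or.inl ⟨hx, hxo⟩

lemma measure_upperBox_boundary (hc : C.1 i < c) (hγ : γ (Icc C.1 C.2 \ openBox C) = 0)
    (hγc : γ (openBox C ∩ {x | x i = c}) = 0) :
    γ (Icc (upperBox C i c).1 (upperBox C i c).2 \ openBox (upperBox C i c)) = 0 := by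
  refine measure_mono_null ?_ (measure_union_null hγ hγc)
  rw [Icc_upperBox hc, openBox_upperBox hc]
  rintro x ⟨⟨hx, hxc⟩, hx'⟩
  by_cases hxo : x ∈ openBox C
  · exact Or.inr ⟨hxo, le_antisymm (not_lt.1 fun h => hx' ⟨hxo, h⟩) hxc⟩
  · exact Or.inl ⟨hx, hxo⟩

lemma disjoint_lowerBox_upperBox (hc : C.1 i < c) (hc' : c < C.2 i) :
    Disjoint (openBox (lowerBox C i c)) (openBox (upperBox C i c)) := by
  rw [openBox_lowerBox hc', openBox_upperBox hc, Set.disjoint_left]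
  rintro x ⟨_, hx⟩ ⟨_, hx'⟩
  exact lt_asymm (mem_ofPred_eq ▸ hx) hx'

lemma measure_openBox_eq_add (hc : C.1 i < c) (hc' : c < C.2 i)
    (hγc : γ (openBox C ∩ {x | x i = c}) = 0) :
    γ (openBox C) = γ (openBox (lowerBox C i c)) + γ (openBox (upperBox C i c)) := by
  rw [← measure_union (disjoint_lowerBox_upperBox hc hc') (isOpen_openBox _).measurableSet]
  refine le_antisymm ?_ (measure_mono ?_)
  · refine (measure_mono (t := (openBox (lowerBox C i c) ∪ openBox (upperBox C i c)) ∪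
      (openBox C ∩ {x | x i = c})) ?_).trans ((measure_union_le _ _).trans_eq
      (by rw [hγc, add_zero]))
    rw [openBox_lowerBox hc', openBox_upperBox hc]
    intro x hx
    rcases lt_trichotomy (x i) c with h | h | h
    · exact Or.inl (Or.inl ⟨hx, h⟩)
    · exact Or.inr ⟨hx, h⟩
    · exact Or.inl (Or.inr ⟨hx, h⟩)
  · rw [openBox_lowerBox hc', openBox_upperBox hc]
    exact union_subset inter_subset_left inter_subset_left

end split

/-- `P` is a partition of the unit cube into boxes whose boundaries are negligible for `α` and `β`
and to which `α` and `β` assign the same mass. -/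
structure Matched (α β : Measure (Fin n → ℝ)) (P : Finset ((Fin n → ℝ) × (Fin n → ℝ))) :
    Prop where
  lt : ∀ C ∈ P, ∀ i, C.1 i < C.2 i
  subset : ∀ C ∈ P, openBox C ⊆ openBox (0, 1)
  cover : ∀ x ∈ Icc (0 : Fin n → ℝ) 1, ∃ C ∈ P, x ∈ Icc C.1 C.2
  disjoint : ∀ C ∈ P, ∀ D ∈ P, C ≠ D → Disjoint (openBox C) (openBox D)
  left_null : ∀ C ∈ P, α (Icc C.1 C.2 \ openBox C) = 0
  right_null : ∀ C ∈ P, β (Icc C.1 C.2 \ openBox C) = 0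
  eq : ∀ C ∈ P, α (openBox C) = β (openBox C)

lemma Matched.symm {α β : Measure (Fin n → ℝ)} {P : Finset ((Fin n → ℝ) × (Fin n → ℝ))}
    (h : Matched α β P) : Matched β α P :=
  ⟨h.lt, h.subset, h.cover, h.disjoint, h.right_null, h.left_null, fun C hC => (h.eq C hC).symm⟩

/-- A cell of a matched partition can be cut in two, near the middle of a given side, after applying
to `β` a homeomorphism supported in that cell. -/
lemma Matched.exists_split {α β : Measure (Fin n → ℝ)} [IsFiniteMeasure α] [IsFiniteMeasure β]
    (hα : IsDiffuse α) (hβ : IsDiffuse β) {P : Finset ((Fin n → ℝ) × (Fin n → ℝ))}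
    (h : Matched α β P) {C : (Fin n → ℝ) × (Fin n → ℝ)} (hC : C ∈ P) (i : Fin n) :
    ∃ c, C.1 i + (C.2 i - C.1 i) / 3 < c ∧ c < C.2 i - (C.2 i - C.1 i) / 3 ∧
      ∃ g : (Fin n → ℝ) ≃ₜ (Fin n → ℝ), (∀ x ∉ openBox C, g x = x) ∧
        Matched α (β.map g.symm)
          (insert (lowerBox C i c) (insert (upperBox C i c) (P.erase C))) := by
  have hlt := h.lt C hC i
  have hcount : Set.Countable {t : ℝ | 0 < (α.restrict (openBox C)) {x | x i = t}} :=
    Measure.countable_meas_level_set_pos (measurable_pi_apply i)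
  obtain ⟨c, ⟨hc1, hc2⟩, hc⟩ := (hcount.dense_compl ℝ).inter_open_nonempty
    (Ioo (C.1 i + (C.2 i - C.1 i) / 3) (C.2 i - (C.2 i - C.1 i) / 3)) isOpen_Ioo
    (nonempty_Ioo.2 (by linarith))
  have hlo : C.1 i < c := by linarith
  have hhi : c < C.2 i := by linarith
  have hαc : α (openBox C ∩ {x | x i = c}) = 0 := by
    have h0 : (α.restrict (openBox C)) {x | x i = c} = 0 := by
      simpa [pos_iff_ne_zero] using hc
    rwa [Measure.restrict_apply' (isOpen_openBox C).measurableSet, inter_comm] at h0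
  have hlow : openBox (lowerBox C i c) ⊆ openBox C :=
    (openBox_lowerBox hhi).subset.trans inter_subset_left
  have hupp : openBox (upperBox C i c) ⊆ openBox C :=
    (openBox_upperBox hlo).subset.trans inter_subset_left
  have hαlow : 0 < α (openBox (lowerBox C i c)) := hα.pos _ (isOpen_openBox _)
    (openBox_nonempty (lowerBox_lt (h.lt C hC) hlo)) (hlow.trans (h.subset C hC))
  have hαupp : 0 < α (openBox (upperBox C i c)) := hα.pos _ (isOpen_openBox _)
    (openBox_nonempty (upperBox_lt (h.lt C hC) hhi)) (hupp.trans (h.subset C hC))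
  have hαadd := measure_openBox_eq_add hlo hhi hαc
  have hslt : α (openBox (lowerBox C i c)) < β (openBox C) := by
    rw [← h.eq C hC, hαadd]
    exact ENNReal.lt_add_right (measure_ne_top _ _) hαupp.ne'
  obtain ⟨g, hg, hgs, hgc⟩ := exists_homeomorph_measure_eq i hlo hhi hβ.atomless hαlow hslt
  rw [← openBox_lowerBox hhi, ← map_symm_apply] at hgs
  rw [← map_symm_apply] at hgc
  have hgC : β.map g.symm (openBox C) = β (openBox C) := by
    rw [map_symm_apply, symm_preimage_eq_of_subset hg subset_rfl]
  have hβbd : β.map g.symm (Icc C.1 C.2 \ openBox C) = 0 := by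
    rw [map_symm_apply, symm_preimage_eq_of_disjoint hg disjoint_sdiff_left]
    exact h.right_null C hC
  have hβadd := measure_openBox_eq_add hlo hhi hgc
  have heq : α (openBox (upperBox C i c)) = β.map g.symm (openBox (upperBox C i c)) := by
    have := h.eq C hC
    rw [← hgC, hαadd, hβadd, hgs] at this
    exact (ENNReal.add_right_inj (measure_ne_top _ _)).1 this
  have hdisj : ∀ D ∈ P.erase C, Disjoint (openBox D) (openBox C) := fun D hD =>
    h.disjoint D (Finset.mem_of_mem_erase hD) C hC (Finset.ne_of_mem_erase hD)
  have hdisj' : ∀ D ∈ P.erase C, Disjoint (Icc D.1 D.2) (openBox C) := fun D hD => by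
    rw [← closure_openBox (h.lt D (Finset.mem_of_mem_erase hD))]
    exact (hdisj D hD).closure_left (isOpen_openBox C)
  have hlu := disjoint_lowerBox_upperBox hlo hhi
  refine ⟨c, hc1, hc2, g, hg, ?_, ?_, ?_, ?_, ?_, ?_, ?_⟩
  · simp only [Finset.forall_mem_insert]
    exact ⟨lowerBox_lt (h.lt C hC) hlo, upperBox_lt (h.lt C hC) hhi,
      fun D hD => h.lt D (Finset.mem_of_mem_erase hD)⟩
  · simp only [Finset.forall_mem_insert]
    exact ⟨hlow.trans (h.subset C hC), hupp.trans (h.subset C hC),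
      fun D hD => h.subset D (Finset.mem_of_mem_erase hD)⟩
  · intro x hx
    obtain ⟨D, hD, hxD⟩ := h.cover x hx
    by_cases hDC : D = C
    · subst hDC
      rw [Icc_eq_lowerBox_union_upperBox hlo hhi] at hxD
      rcases hxD with hxD | hxD
      · exact ⟨_, by simp, hxD⟩
      · exact ⟨_, by simp, hxD⟩
    · exact ⟨D, by simp [hD, hDC], hxD⟩
  · have hl : ∀ D ∈ P.erase C, Disjoint (openBox (lowerBox C i c)) (openBox D) := fun D hD =>
      ((hdisj D hD).mono_right hlow).symm
    have hu : ∀ D ∈ P.erase C, Disjoint (openBox (upperBox C i c)) (openBox D) := fun D hD =>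
      ((hdisj D hD).mono_right hupp).symm
    simp only [Finset.forall_mem_insert]
    refine ⟨⟨fun h => absurd rfl h, fun _ => hlu, fun D hD _ => hl D hD⟩,
      ⟨fun _ => hlu.symm, fun h => absurd rfl h, fun D hD _ => hu D hD⟩, fun D hD =>
      ⟨fun _ => (hl D hD).symm, fun _ => (hu D hD).symm, fun D' hD' => ?_⟩⟩
    exact h.disjoint D (Finset.mem_of_mem_erase hD) D' (Finset.mem_of_mem_erase hD')
  · simp only [Finset.forall_mem_insert]
    exact ⟨measure_lowerBox_boundary hhi (h.left_null C hC) hαc,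
      measure_upperBox_boundary hlo (h.left_null C hC) hαc,
      fun D hD => h.left_null D (Finset.mem_of_mem_erase hD)⟩
  · simp only [Finset.forall_mem_insert]
    refine ⟨measure_lowerBox_boundary hhi hβbd hgc, measure_upperBox_boundary hlo hβbd hgc,
      fun D hD => ?_⟩
    rw [map_symm_apply, symm_preimage_eq_of_disjoint hg ((hdisj' D hD).mono_left sdiff_subset)]
    exact h.right_null D (Finset.mem_of_mem_erase hD)
  · simp only [Finset.forall_mem_insert]
    refine ⟨hgs.symm, heq, fun D hD => ?_⟩
    rw [map_symm_apply, symm_preimage_eq_of_disjoint hg (hdisj D hD)]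
    exact h.eq D (Finset.mem_of_mem_erase hD)

/-- Every cell of `P'` lies in a cell of `P`, and every cell of `P` is a union of cells of `P'`. -/
structure Refines (P' P : Finset ((Fin n → ℝ) × (Fin n → ℝ))) : Prop where
  exists_superset : ∀ D ∈ P', ∃ C ∈ P, Icc D.1 D.2 ⊆ Icc C.1 C.2
  exists_subset : ∀ C ∈ P, ∀ x ∈ Icc C.1 C.2, ∃ D ∈ P', x ∈ Icc D.1 D.2 ∧
    Icc D.1 D.2 ⊆ Icc C.1 C.2

lemma Refines.refl (P : Finset ((Fin n → ℝ) × (Fin n → ℝ))) : Refines P P :=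
  ⟨fun D hD => ⟨D, hD, subset_rfl⟩, fun C hC _ hx => ⟨C, hC, hx, subset_rfl⟩⟩

lemma Refines.trans {P'' P' P : Finset ((Fin n → ℝ) × (Fin n → ℝ))} (h' : Refines P'' P')
    (h : Refines P' P) : Refines P'' P where
  exists_superset D hD := by
    obtain ⟨C', hC', h1⟩ := h'.exists_superset D hD
    obtain ⟨C, hC, h2⟩ := h.exists_superset C' hC'
    exact ⟨C, hC, h1.trans h2⟩
  exists_subset C hC x hx := by
    obtain ⟨C', hC', hx', h1⟩ := h.exists_subset C hC x hx
    obtain ⟨D, hD, hxD, h2⟩ := h'.exists_subset C' hC' x hx'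
    exact ⟨D, hD, hxD, h2.trans h1⟩

/-- The homeomorphism `g` maps every cell of `P` onto itself. -/
def Preserves (g : (Fin n → ℝ) ≃ₜ (Fin n → ℝ)) (P : Finset ((Fin n → ℝ) × (Fin n → ℝ))) : Prop :=
  ∀ C ∈ P, ∀ x, g x ∈ Icc C.1 C.2 ↔ x ∈ Icc C.1 C.2

lemma Preserves.of_refines {g : (Fin n → ℝ) ≃ₜ (Fin n → ℝ)}
    {P' P : Finset ((Fin n → ℝ) × (Fin n → ℝ))} (hg : Preserves g P') (h : Refines P' P) :
    Preserves g P := by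
  intro C hC x
  refine ⟨fun hx => ?_, fun hx => ?_⟩
  · obtain ⟨D, hD, hxD, hDC⟩ := h.exists_subset C hC _ hx
    exact hDC ((hg D hD x).1 hxD)
  · obtain ⟨D, hD, hxD, hDC⟩ := h.exists_subset C hC _ hx
    exact hDC ((hg D hD x).2 hxD)

lemma refines_split {P : Finset ((Fin n → ℝ) × (Fin n → ℝ))} {C : (Fin n → ℝ) × (Fin n → ℝ)}
    (hC : C ∈ P) {i : Fin n} {c : ℝ} (hlo : C.1 i < c) (hhi : c < C.2 i) :
    Refines (insert (lowerBox C i c) (insert (upperBox C i c) (P.erase C))) P := by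
  have hunion := Icc_eq_lowerBox_union_upperBox hlo hhi
  have hl : Icc (lowerBox C i c).1 (lowerBox C i c).2 ⊆ Icc C.1 C.2 :=
    hunion ▸ subset_union_left
  have hu : Icc (upperBox C i c).1 (upperBox C i c).2 ⊆ Icc C.1 C.2 :=
    hunion ▸ subset_union_right
  constructor
  · simp only [Finset.forall_mem_insert]
    exact ⟨⟨C, hC, hl⟩, ⟨C, hC, hu⟩, fun D hD => ⟨D, Finset.mem_of_mem_erase hD, subset_rfl⟩⟩
  · intro D hD x hx
    by_cases hDC : D = C
    · subst hDC
      rcases hunion.subset hx with hx | hx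
      · exact ⟨_, by simp, hx, hl⟩
      · exact ⟨_, by simp, hx, hu⟩
    · exact ⟨D, by simp [hD, hDC], hx, subset_rfl⟩

/-- A number controlling how often a box has to be cut until its sides are shorter than `δ`. -/
noncomputable def cutBound (δ : ℝ) (C : (Fin n → ℝ) × (Fin n → ℝ)) : ℕ :=
  ⌈(∑ i, (C.2 i - C.1 i)) * 3 / δ⌉₊

lemma cutBound_lt {δ : ℝ} (hδ : 0 < δ) {C D : (Fin n → ℝ) × (Fin n → ℝ)}
    (hD : ∀ j, D.1 j ≤ D.2 j) (h : ∑ j, (D.2 j - D.1 j) + δ / 3 ≤ ∑ j, (C.2 j - C.1 j)) :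
    cutBound δ D < cutBound δ C := by
  have h0 : 0 ≤ (∑ j, (D.2 j - D.1 j)) * 3 / δ := by
    have : 0 ≤ ∑ j, (D.2 j - D.1 j) := Finset.sum_nonneg fun j _ => sub_nonneg.2 (hD j)
    positivity
  rw [← Nat.succ_le_iff, Nat.succ_eq_add_one, cutBound, cutBound, ← Nat.ceil_add_one h0]
  refine Nat.ceil_mono ?_
  rw [div_add_one hδ.ne']
  gcongr
  linarith

lemma sum_lowerBox (C : (Fin n → ℝ) × (Fin n → ℝ)) (i : Fin n) (c : ℝ) :
    ∑ j, ((lowerBox C i c).2 j - (lowerBox C i c).1 j) + (C.2 i - c) =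
      ∑ j, (C.2 j - C.1 j) := by
  rw [← Finset.add_sum_erase _ _ (Finset.mem_univ i),
    ← Finset.add_sum_erase _ (fun j => C.2 j - C.1 j) (Finset.mem_univ i),
    Finset.sum_congr rfl fun j hj => show (lowerBox C i c).2 j - (lowerBox C i c).1 j =
      C.2 j - C.1 j by simp [lowerBox, Finset.ne_of_mem_erase hj]]
  simp [lowerBox]
  ring

lemma sum_upperBox (C : (Fin n → ℝ) × (Fin n → ℝ)) (i : Fin n) (c : ℝ) :
    ∑ j, ((upperBox C i c).2 j - (upperBox C i c).1 j) + (c - C.1 i) =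
      ∑ j, (C.2 j - C.1 j) := by
  rw [← Finset.add_sum_erase _ _ (Finset.mem_univ i),
    ← Finset.add_sum_erase _ (fun j => C.2 j - C.1 j) (Finset.mem_univ i),
    Finset.sum_congr rfl fun j hj => show (upperBox C i c).2 j - (upperBox C i c).1 j =
      C.2 j - C.1 j by simp [upperBox, Finset.ne_of_mem_erase hj]]
  simp [upperBox]
  ring

/-- A matched partition has matched refinements with arbitrarily small cells, after applying to `β`
a homeomorphism which preserves the cells of the original partition. -/
lemma Matched.exists_refinement {α : Measure (Fin n → ℝ)} [IsFiniteMeasure α] (hα : IsDiffuse α)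
    {δ : ℝ} (hδ : 0 < δ) {β : Measure (Fin n → ℝ)} [IsFiniteMeasure β] (hβ : IsDiffuse β)
    {P : Finset ((Fin n → ℝ) × (Fin n → ℝ))} (h : Matched α β P) :
    ∃ (g : (Fin n → ℝ) ≃ₜ (Fin n → ℝ)) (P' : Finset ((Fin n → ℝ) × (Fin n → ℝ))),
      (∀ x ∉ openBox (0, 1), g x = x) ∧ Preserves g P ∧ Refines P' P ∧
      Matched α (β.map g.symm) P' ∧ ∀ D ∈ P', ∀ i, D.2 i - D.1 i < δ := by
  induction hN : ∑ C ∈ P, 3 ^ cutBound δ C using Nat.strong_induction_on generalizing β P with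
  | _ N ih =>
  subst hN
  by_cases hsmall : ∀ D ∈ P, ∀ i, D.2 i - D.1 i < δ
  · refine ⟨Homeomorph.refl _, P, fun x _ => rfl, fun C _ x => Iff.rfl, Refines.refl P, ?_, hsmall⟩
    have : β.map (Homeomorph.refl (Fin n → ℝ)).symm = β := Measure.map_id
    rwa [this]
  push Not at hsmall
  obtain ⟨C, hC, i, hi⟩ := hsmall
  obtain ⟨c, hc1, hc2, g₁, hg₁, hm₁⟩ := h.exists_split hα hβ hC i
  have hlt := h.lt C hC i
  have hlo : C.1 i < c := by linarith
  have hhi : c < C.2 i := by linarith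
  have href := refines_split hC hlo hhi
  have hg₁' : ∀ x ∉ openBox (0, 1), g₁ x = x := fun x hx => hg₁ x fun h' => hx (h.subset C hC h')
  have hpres₁ : Preserves g₁ P := by
    intro D hD x
    have hpre : g₁.symm ⁻¹' Icc D.1 D.2 = Icc D.1 D.2 := by
      by_cases hDC : D = C
      · exact symm_preimage_eq_of_subset hg₁ (hDC ▸ openBox_subset_Icc D)
      · refine symm_preimage_eq_of_disjoint hg₁ ?_
        rw [← closure_openBox (h.lt D hD)]
        exact (h.disjoint D hD C hC hDC).closure_left (isOpen_openBox C)
    conv_lhs => rw [← hpre, mem_preimage, Homeomorph.symm_apply_apply]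
  have hfin : IsFiniteMeasure (β.map g₁.symm) := Measure.isFiniteMeasure_map β _
  have hlow := cutBound_lt hδ (D := lowerBox C i c) (C := C)
    (fun j => (lowerBox_lt (h.lt C hC) hlo j).le) (by have := sum_lowerBox C i c; linarith)
  have hupp := cutBound_lt hδ (D := upperBox C i c) (C := C)
    (fun j => (upperBox_lt (h.lt C hC) hhi j).le) (by have := sum_upperBox C i c; linarith)
  have hdecr : ∑ D ∈ insert (lowerBox C i c) (insert (upperBox C i c) (P.erase C)),
      3 ^ cutBound δ D < ∑ D ∈ P, 3 ^ cutBound δ D := by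
    have hins : ∀ (D : (Fin n → ℝ) × (Fin n → ℝ)) (s : Finset ((Fin n → ℝ) × (Fin n → ℝ))),
        ∑ B ∈ insert D s, 3 ^ cutBound δ B ≤ 3 ^ cutBound δ D + ∑ B ∈ s, 3 ^ cutBound δ B := by
      intro D s
      by_cases hD : D ∈ s
      · rw [Finset.insert_eq_of_mem hD]; exact Nat.le_add_left _ _
      · exact (Finset.sum_insert hD).le
    have h1 := hins (lowerBox C i c) (insert (upperBox C i c) (P.erase C))
    have h2 := hins (upperBox C i c) (P.erase C)
    have h3 := Finset.add_sum_erase P (fun D => 3 ^ cutBound δ D) hC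
    have h4 := Nat.pow_le_pow_right (by norm_num : 0 < 3) (Nat.succ_le_of_lt hlow)
    have h5 := Nat.pow_le_pow_right (by norm_num : 0 < 3) (Nat.succ_le_of_lt hupp)
    have h6 : 0 < 3 ^ cutBound δ (lowerBox C i c) := by positivity
    rw [Nat.pow_succ] at h4 h5
    omega
  obtain ⟨g₂, P', hg₂, hpres, href', hm₂, hsm⟩ := ih _ hdecr (hβ.map_symm hg₁') hm₁ rfl
  refine ⟨g₂.trans g₁, P', fun x hx => ?_, ?_, href'.trans href, ?_, hsm⟩
  · rw [Homeomorph.trans_apply, hg₂ x hx, hg₁' x hx]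
  · intro D hD x
    rw [Homeomorph.trans_apply, hpres₁ D hD, hpres.of_refines href D hD x]
  · rw [Measure.map_map g₂.symm.measurable g₁.symm.measurable] at hm₂
    exact hm₂

/-! ### Successive approximation -/

/-- A pair of homeomorphisms `a`, `b` supported in the unit cube, together with a partition of the
cube into boxes `C` such that `μ (a C) = ν (b C)`. -/
structure Stage (μ ν : Measure (Fin n → ℝ)) where
  /-- The homeomorphism applied on the side of `μ`. -/
  a : (Fin n → ℝ) ≃ₜ (Fin n → ℝ)
  /-- The homeomorphism applied on the side of `ν`. -/
  b : (Fin n → ℝ) ≃ₜ (Fin n → ℝ)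
  /-- The partition into boxes. -/
  P : Finset ((Fin n → ℝ) × (Fin n → ℝ))
  a_apply : ∀ x ∉ openBox (0, 1), a x = x
  b_apply : ∀ x ∉ openBox (0, 1), b x = x
  matched : Matched (μ.map a.symm) (ν.map b.symm) P

/-- The cells of `P` have the same images under `a` and `a'`. -/
def SameImages (P : Finset ((Fin n → ℝ) × (Fin n → ℝ))) (a a' : (Fin n → ℝ) ≃ₜ (Fin n → ℝ)) :
    Prop :=
  ∀ C ∈ P, ∀ x, a'.symm x ∈ Icc C.1 C.2 ↔ a.symm x ∈ Icc C.1 C.2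

/-- The images under `a` of the cells of `P` have diameter at most `ε`. -/
def SmallImages (P : Finset ((Fin n → ℝ) × (Fin n → ℝ))) (a : (Fin n → ℝ) ≃ₜ (Fin n → ℝ))
    (ε : ℝ) : Prop :=
  ∀ C ∈ P, ∀ x y, a.symm x ∈ Icc C.1 C.2 → a.symm y ∈ Icc C.1 C.2 → dist x y ≤ ε

section images

variable {P P' : Finset ((Fin n → ℝ) × (Fin n → ℝ))} {a a' : (Fin n → ℝ) ≃ₜ (Fin n → ℝ)} {ε : ℝ}

lemma SameImages.of_refines (h : SameImages P' a a') (hP : Refines P' P) : SameImages P a a' := by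
  intro C hC x
  refine ⟨fun hx => ?_, fun hx => ?_⟩
  · obtain ⟨D, hD, hxD, hDC⟩ := hP.exists_subset C hC _ hx
    exact hDC ((h D hD x).1 hxD)
  · obtain ⟨D, hD, hxD, hDC⟩ := hP.exists_subset C hC _ hx
    exact hDC ((h D hD x).2 hxD)

lemma SmallImages.of_sameImages (h : SmallImages P a ε) (h' : SameImages P a a') :
    SmallImages P a' ε :=
  fun C hC x y hx hy => h C hC x y ((h' C hC x).1 hx) ((h' C hC y).1 hy)

lemma SmallImages.of_refines (h : SmallImages P a ε) (hP : Refines P' P) :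
    SmallImages P' a ε := by
  intro D hD x y hx hy
  obtain ⟨C, hC, hDC⟩ := hP.exists_superset D hD
  exact h C hC x y (hDC hx) (hDC hy)

end images

lemma mem_Icc_of_symm_mem {a : (Fin n → ℝ) ≃ₜ (Fin n → ℝ)} (ha : ∀ x ∉ openBox (0, 1), a x = x)
    {x : Fin n → ℝ} (hx : x ∈ Icc (0 : Fin n → ℝ) 1) : a.symm x ∈ Icc (0 : Fin n → ℝ) 1 := by
  have h := symm_preimage_eq_of_subset ha (openBox_subset_Icc (0, 1))
  exact h.superset hx

namespace Stage

variable {μ ν : Measure (Fin n → ℝ)}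

/-- Exchange of the two sides of a stage. -/
def symm (S : Stage μ ν) : Stage ν μ :=
  ⟨S.b, S.a, S.P, S.b_apply, S.a_apply, S.matched.symm⟩

lemma exists_next_left [IsFiniteMeasure μ] [IsFiniteMeasure ν] (hμ : IsDiffuse μ)
    (hν : IsDiffuse ν) (S : Stage μ ν) {ε : ℝ} (hε : 0 < ε) :
    ∃ S' : Stage μ ν, Refines S'.P S.P ∧ S'.a = S.a ∧ SameImages S.P S.b S'.b ∧
      SmallImages S'.P S'.a ε := by
  obtain ⟨δ, hδ, hδε⟩ := Metric.uniformContinuousOn_iff_le.1 ((isCompact_Icc (a := (0 : Fin n → ℝ))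
    (b := 1)).uniformContinuousOn_of_continuous S.a.continuous.continuousOn) ε hε
  have : IsFiniteMeasure (μ.map S.a.symm) := Measure.isFiniteMeasure_map μ _
  have : IsFiniteMeasure (ν.map S.b.symm) := Measure.isFiniteMeasure_map ν _
  obtain ⟨g, P', hg, hpres, href, hm, hsmall⟩ := S.matched.exists_refinement
    (hμ.map_symm S.a_apply) hδ (hν.map_symm S.b_apply)
  rw [Measure.map_map g.symm.measurable S.b.symm.measurable] at hm
  refine ⟨⟨S.a, g.trans S.b, P', S.a_apply, fun x hx => ?_, hm⟩, href, rfl, ?_, ?_⟩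
  · rw [Homeomorph.trans_apply, hg x hx, S.b_apply x hx]
  · intro C hC x
    have := hpres C hC (g.symm (S.b.symm x))
    rw [Homeomorph.apply_symm_apply] at this
    exact this.symm
  · intro D hD x y hx hy
    have hsub : Icc D.1 D.2 ⊆ Icc (0 : Fin n → ℝ) 1 := by
      rw [← closure_openBox (hm.lt D hD)]
      exact closure_minimal ((hm.subset D hD).trans (openBox_subset_Icc (0, 1))) isClosed_Icc
    have hd := hδε _ (hsub hx) _ (hsub hy) ((dist_pi_le_iff hδ.le).2 fun i => by
      have h1 := hx.1 i
      have h2 := hx.2 i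
      have h3 := hy.1 i
      have h4 := hy.2 i
      have h5 := hsmall D hD i
      rw [Real.dist_eq, abs_le]
      constructor <;> linarith)
    simpa using hd

lemma exists_next [IsFiniteMeasure μ] [IsFiniteMeasure ν] (hμ : IsDiffuse μ)
    (hν : IsDiffuse ν) (S : Stage μ ν) {ε : ℝ} (hε : 0 < ε) :
    ∃ S' : Stage μ ν, SameImages S.P S.a S'.a ∧ SameImages S.P S.b S'.b ∧
      SmallImages S'.P S'.a ε ∧ SmallImages S'.P S'.b ε := by
  obtain ⟨S₁, href₁, ha₁, hb₁, hsm₁⟩ := S.exists_next_left hμ hν hε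
  obtain ⟨S₂, href₂, hb₂, ha₂, hsm₂⟩ := S₁.symm.exists_next_left hν hμ hε
  refine ⟨S₂.symm, ?_, ?_, (hsm₁.of_sameImages ha₂).of_refines href₂, hsm₂⟩
  · have := ha₂.of_refines href₁
    rwa [show S₁.symm.b = S₁.a from rfl, ha₁] at this
  · rw [show S₂.symm.b = S₁.b from hb₂]
    exact hb₁

lemma dist_apply_le {S S' : Stage μ ν} (ha : SameImages S.P S.a S'.a)
    (hb : SameImages S.P S.b S'.b) {ε : ℝ} (hε : 0 ≤ ε) (hsm : SmallImages S.P S.b ε)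
    (x : Fin n → ℝ) : dist (S.b (S.a.symm x)) (S'.b (S'.a.symm x)) ≤ ε := by
  by_cases hx : x ∈ openBox (0, 1)
  · obtain ⟨C, hC, hxC⟩ := S.matched.cover _
      (mem_Icc_of_symm_mem S.a_apply (openBox_subset_Icc (0, 1) hx))
    refine hsm C hC _ _ (by simpa using hxC) ((hb C hC _).1 ?_)
    simpa using (ha C hC x).2 hxC
  · rw [symm_apply_of_notMem S.a_apply hx, symm_apply_of_notMem S'.a_apply hx, S.b_apply x hx,
      S'.b_apply x hx, dist_self]
    exact hε

end Stage

/-- A sequence of successively finer stages. -/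
structure StageSeq (μ ν : Measure (Fin n → ℝ)) where
  /-- The stages of the sequence. -/
  stage : ℕ → Stage μ ν
  same_a : ∀ k, SameImages (stage k).P (stage k).a (stage (k + 1)).a
  same_b : ∀ k, SameImages (stage k).P (stage k).b (stage (k + 1)).b
  small_a : ∀ k, SmallImages (stage k).P (stage k).a ((1 / 2) ^ k)
  small_b : ∀ k, SmallImages (stage k).P (stage k).b ((1 / 2) ^ k)

namespace StageSeq

variable {μ ν : Measure (Fin n → ℝ)}

/-- Exchange of the two sides of a sequence of stages. -/
def symm (S : StageSeq μ ν) : StageSeq ν μ :=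
  ⟨fun k => (S.stage k).symm, S.same_b, S.same_a, S.small_b, S.small_a⟩

lemma exists_of_stage [IsFiniteMeasure μ] [IsFiniteMeasure ν] (hμ : IsDiffuse μ)
    (hν : IsDiffuse ν) (S₀ : Stage μ ν) : Nonempty (StageSeq μ ν) := by
  choose next hna hnb hsa hsb using fun (S : Stage μ ν) (k : ℕ) =>
    S.exists_next hμ hν (show (0 : ℝ) < (1 / 2) ^ k by positivity)
  let s : ℕ → Stage μ ν := fun k => Nat.rec (next S₀ 0) (fun k S => next S (k + 1)) k
  exact ⟨⟨s, fun k => hna _ _, fun k => hnb _ _, fun k => by cases k <;> exact hsa _ _,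
    fun k => by cases k <;> exact hsb _ _⟩⟩

/-- The approximation at stage `k` to a homeomorphism carrying `μ` to `ν`. -/
def approx (S : StageSeq μ ν) (k : ℕ) (x : Fin n → ℝ) : Fin n → ℝ :=
  (S.stage k).b ((S.stage k).a.symm x)

lemma exists_limit (S : StageSeq μ ν) : ∃ f : (Fin n → ℝ) → Fin n → ℝ, Continuous f ∧
    TendstoUniformly S.approx f atTop ∧ (∀ k x, dist (S.approx k x) (f x) ≤ 2 * (1 / 2) ^ k) ∧
    ∀ x ∉ openBox (0, 1), f x = x := by
  have hd : ∀ x k, dist (S.approx k x) (S.approx (k + 1) x) ≤ 1 * (1 / 2) ^ k := fun x k => by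
    rw [one_mul]
    exact Stage.dist_apply_le (S.same_a k) (S.same_b k) (by positivity) (S.small_b k) x
  choose f hf using fun x => cauchySeq_tendsto_of_complete
    (cauchySeq_of_le_geometric (1 / 2) 1 (by norm_num) (hd x))
  have hdist : ∀ k x, dist (S.approx k x) (f x) ≤ 2 * (1 / 2) ^ k := fun k x => by
    refine (dist_le_of_le_geometric_of_tendsto (1 / 2) 1 (by norm_num) (hd x) (hf x) k).trans_eq ?_
    ring
  have hlim : Tendsto (fun k : ℕ => 2 * (1 / 2 : ℝ) ^ k) atTop (𝓝 0) := by
    simpa using (tendsto_pow_atTop_nhds_zero_of_lt_one (by norm_num : (0 : ℝ) ≤ 1 / 2)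
      (by norm_num)).const_mul 2
  have hunif : TendstoUniformly S.approx f atTop := by
    rw [Metric.tendstoUniformly_iff]
    intro ε hε
    filter_upwards [hlim.eventually_lt_const hε] with k hk x
    rw [dist_comm]
    exact (hdist k x).trans_lt hk
  refine ⟨f, hunif.continuous (Frequently.of_forall fun k => ?_), hunif, hdist, fun x hx => ?_⟩
  · exact (S.stage k).b.continuous.comp (S.stage k).a.symm.continuous
  · refine tendsto_nhds_unique (hf x) (tendsto_const_nhds.congr fun k => ?_)
    rw [approx, symm_apply_of_notMem (S.stage k).a_apply hx, (S.stage k).b_apply x hx]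

lemma measure_preimage_le [IsFiniteMeasure ν] (S : StageSeq μ ν)
    (hμ : μ (Icc (0 : Fin n → ℝ) 1)ᶜ = 0) {f : (Fin n → ℝ) → Fin n → ℝ}
    (hf : ∀ k x, dist (S.approx k x) (f x) ≤ 2 * (1 / 2) ^ k) {F : Set (Fin n → ℝ)}
    (hF : IsClosed F) : μ (f ⁻¹' F) ≤ ν F := by
  classical
  have hlim : Tendsto (fun k : ℕ => 3 * (1 / 2 : ℝ) ^ k) atTop (𝓝 0) := by
    simpa using (tendsto_pow_atTop_nhds_zero_of_lt_one (by norm_num : (0 : ℝ) ≤ 1 / 2)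
      (by norm_num)).const_mul 3
  refine ge_of_tendsto' ((tendsto_measure_cthickening_of_isClosed (μ := ν)
    ⟨1, one_pos, measure_ne_top _ _⟩ hF).comp hlim) fun k => ?_
  set T := S.stage k with hT
  set P' := T.P.filter fun C => ∀ y, T.b.symm y ∈ Icc C.1 C.2 →
    y ∈ Metric.cthickening (3 * (1 / 2) ^ k) F with hP'
  have hsub : f ⁻¹' F ⊆ (Icc (0 : Fin n → ℝ) 1)ᶜ ∪ ⋃ C ∈ P', T.a.symm ⁻¹' Icc C.1 C.2 := by
    intro x hx
    by_cases hxQ : x ∈ Icc (0 : Fin n → ℝ) 1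
    · right
      obtain ⟨C, hC, hxC⟩ := T.matched.cover _ (mem_Icc_of_symm_mem T.a_apply hxQ)
      refine mem_biUnion (Finset.mem_coe.2 (Finset.mem_filter.2 ⟨hC, fun y hy => ?_⟩)) hxC
      refine Metric.mem_cthickening_of_dist_le y (f x) _ _ hx ?_
      have h1 := S.small_b k C hC y (T.b (T.a.symm x)) hy (by simpa [← hT] using hxC)
      have h2 := hf k x
      have h3 := dist_triangle y (S.approx k x) (f x)
      have h4 : dist y (S.approx k x) ≤ (1 / 2) ^ k := h1
      linarith
    · exact Or.inl hxQ
  have hcell : ∀ C ∈ P', μ (T.a.symm ⁻¹' Icc C.1 C.2) ≤ ν (T.b.symm ⁻¹' openBox C) := by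
    intro C hC
    have hCP := (Finset.mem_filter.1 hC).1
    rw [← map_symm_apply, ← map_symm_apply, ← T.matched.eq C hCP]
    have h := measure_union_le (μ := μ.map T.a.symm) (openBox C) (Icc C.1 C.2 \ openBox C)
    rwa [union_sdiff_cancel (openBox_subset_Icc C), T.matched.left_null C hCP, add_zero] at h
  calc μ (f ⁻¹' F) ≤ μ (Icc (0 : Fin n → ℝ) 1)ᶜ + μ (⋃ C ∈ P', T.a.symm ⁻¹' Icc C.1 C.2) :=
        (measure_mono hsub).trans (measure_union_le _ _)
    _ = μ (⋃ C ∈ P', T.a.symm ⁻¹' Icc C.1 C.2) := by rw [hμ, zero_add]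
    _ ≤ ∑ C ∈ P', μ (T.a.symm ⁻¹' Icc C.1 C.2) := measure_biUnion_finset_le _ _
    _ ≤ ∑ C ∈ P', ν (T.b.symm ⁻¹' openBox C) := Finset.sum_le_sum hcell
    _ = ν (⋃ C ∈ P', T.b.symm ⁻¹' openBox C) := by
        refine (measure_biUnion_finset (fun C hC D hD hCD => ?_) fun C _ => ?_).symm
        · exact (T.matched.disjoint C (Finset.mem_filter.1 hC).1 D (Finset.mem_filter.1 hD).1
            hCD).preimage _
        · exact ((isOpen_openBox C).preimage T.b.symm.continuous).measurableSet
    _ ≤ ν (Metric.cthickening (3 * (1 / 2) ^ k) F) := by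
        refine measure_mono (iUnion₂_subset fun C hC y hy => ?_)
        exact (Finset.mem_filter.1 hC).2 y (openBox_subset_Icc C hy)

lemma exists_homeomorph [IsFiniteMeasure μ] [IsFiniteMeasure ν] (S : StageSeq μ ν)
    (hμ : μ (Icc (0 : Fin n → ℝ) 1)ᶜ = 0) (hν : ν (Icc (0 : Fin n → ℝ) 1)ᶜ = 0) :
    ∃ f : (Fin n → ℝ) ≃ₜ (Fin n → ℝ), (∀ x ∉ openBox (0, 1), f x = x) ∧ μ.map f = ν := by
  obtain ⟨f, hfc, hfu, hfd, hfx⟩ := S.exists_limit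
  obtain ⟨f', hfc', hfu', hfd', -⟩ := S.symm.exists_limit
  have hleft : ∀ x, f' (f x) = x := by
    intro x
    refine tendsto_nhds_unique (hfu'.tendsto_comp hfc'.continuousAt (hfu.tendsto_at x))
      (tendsto_const_nhds.congr fun k => ?_)
    simp [approx, symm, Stage.symm]
  have hright : ∀ x, f (f' x) = x := by
    intro x
    refine tendsto_nhds_unique (hfu.tendsto_comp hfc.continuousAt (hfu'.tendsto_at x))
      (tendsto_const_nhds.congr fun k => ?_)
    simp [approx, symm, Stage.symm]
  refine ⟨⟨⟨f, f', hleft, hright⟩, hfc, hfc'⟩, hfx, ?_⟩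
  have hclosed : ∀ F, IsClosed F → μ (f ⁻¹' F) = ν F := fun F hF => by
    refine le_antisymm (S.measure_preimage_le hμ hfd hF) ?_
    have := S.symm.measure_preimage_le hν hfd' (hF.preimage hfc)
    rwa [← preimage_comp, show f ∘ f' = id from funext hright, preimage_id] at this
  have : IsFiniteMeasure (μ.map f) := Measure.isFiniteMeasure_map μ f
  refine ext_of_generate_finite {F : Set (Fin n → ℝ) | IsClosed F}
    (BorelSpace.measurable_eq.trans borel_eq_generateFrom_isClosed) isPiSystem_isClosed ?_ ?_
  · intro F hF
    exact (Measure.map_apply hfc.measurable (IsClosed.measurableSet hF)).trans (hclosed F hF)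
  · exact (Measure.map_apply hfc.measurable MeasurableSet.univ).trans (hclosed _ isClosed_univ)

end StageSeq

/-- Homeomorphisms carrying one diffuse measure on the cube to another of the same mass. -/
lemma exists_homeomorph_map_eq {μ ν : Measure (Fin n → ℝ)} [IsFiniteMeasure μ]
    [IsFiniteMeasure ν] (hμ : IsDiffuse μ) (hν : IsDiffuse ν) (hμQ : μ (openBox (0, 1))ᶜ = 0)
    (hνQ : ν (openBox (0, 1))ᶜ = 0) (h : μ univ = ν univ) :
    ∃ f : (Fin n → ℝ) ≃ₜ (Fin n → ℝ), (∀ x ∉ openBox (0, 1), f x = x) ∧ μ.map f = ν := by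
  have hid : ∀ γ : Measure (Fin n → ℝ), γ.map (Homeomorph.refl (Fin n → ℝ)).symm = γ :=
    fun γ => Measure.map_id
  have huniv : ∀ γ : Measure (Fin n → ℝ), γ (openBox (0, 1))ᶜ = 0 → γ (openBox (0, 1)) = γ univ :=
    fun γ hγ => by
      rw [← measure_add_measure_compl (isOpen_openBox (0, 1)).measurableSet, hγ, add_zero]
  have hsub : Icc (0 : Fin n → ℝ) 1 \ openBox (0, 1) ⊆ (openBox (0, 1))ᶜ := fun x hx => hx.2
  have hmatched : Matched μ ν {((0 : Fin n → ℝ), (1 : Fin n → ℝ))} := by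
    constructor <;> simp only [Finset.mem_singleton, forall_eq, exists_eq_left]
    · exact fun i => zero_lt_one
    · exact subset_rfl
    · exact fun x hx => hx
    · exact fun h => absurd rfl h
    · exact measure_mono_null hsub hμQ
    · exact measure_mono_null hsub hνQ
    · rw [huniv μ hμQ, huniv ν hνQ, h]
  obtain ⟨S⟩ := StageSeq.exists_of_stage hμ hν ⟨Homeomorph.refl _, Homeomorph.refl _,
    {(0, 1)}, fun x _ => rfl, fun x _ => rfl, by rwa [hid, hid]⟩
  have hcompl : (Icc (0 : Fin n → ℝ) 1)ᶜ ⊆ (openBox (0, 1))ᶜ :=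
    compl_subset_compl.2 (openBox_subset_Icc (0, 1))
  exact S.exists_homeomorph (measure_mono_null hcompl hμQ) (measure_mono_null hcompl hνQ)

/-! ### Measures on the unit cube -/

lemma measurableEmbedding_coe_unitCube :
    MeasurableEmbedding (Subtype.val : unitCube n → Fin n → ℝ) :=
  MeasurableEmbedding.subtype_coe measurableSet_Icc

lemma isDiffuse_map_coe {μ : Measure (unitCube n)} (hatom : ∀ p, μ {p} = 0)
    (hpos : ∀ U : Set (unitCube n), IsOpen U → U.Nonempty → 0 < μ U) :
    IsDiffuse (μ.map Subtype.val) where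
  atomless x := by
    rw [measurableEmbedding_coe_unitCube.map_apply]
    by_cases hx : x ∈ unitCube n
    · refine measure_mono_null ?_ (hatom ⟨x, hx⟩)
      exact fun y hy => Subtype.ext hy
    · refine measure_mono_null (t := ∅) (fun y hy => ?_) measure_empty
      exact hx (mem_singleton_iff.1 hy ▸ y.2)
  pos U hU hne hsub := by
    rw [measurableEmbedding_coe_unitCube.map_apply]
    obtain ⟨x, hx⟩ := hne
    exact hpos _ (hU.preimage continuous_subtype_val)
      ⟨⟨x, openBox_subset_Icc (0, 1) (hsub hx)⟩, hx⟩

lemma map_coe_compl_openBox {μ : Measure (unitCube n)} (h : μ (cubeBoundary n) = 0) :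
    μ.map Subtype.val (openBox (0, 1))ᶜ = 0 := by
  rw [measurableEmbedding_coe_unitCube.map_apply]
  exact h

end OxtobyUlam

theorem stmt14 (n : ℕ) (hn : 1 ≤ n)
    (μ ν : Measure ↥(unitCube n)) [IsFiniteMeasure μ] [IsFiniteMeasure ν]
    (hμatom : ∀ p : ↥(unitCube n), μ {p} = 0)
    (hνatom : ∀ p : ↥(unitCube n), ν {p} = 0)
    (hμpos : ∀ U : Set ↥(unitCube n), IsOpen U → U.Nonempty → 0 < μ U)
    (hνpos : ∀ U : Set ↥(unitCube n), IsOpen U → U.Nonempty → 0 < ν U)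
    (hmubd : μ (cubeBoundary n) = 0) (hnubd : ν (cubeBoundary n) = 0)
    (htotal : μ Set.univ = ν Set.univ) :
    ∃ h : ↥(unitCube n) ≃ₜ ↥(unitCube n),
      (∀ x ∈ cubeBoundary n, h x = x) ∧ Measure.map h μ = ν := by
  have hemb := OxtobyUlam.measurableEmbedding_coe_unitCube (n := n)
  have : IsFiniteMeasure (μ.map Subtype.val) := Measure.isFiniteMeasure_map μ _
  have : IsFiniteMeasure (ν.map Subtype.val) := Measure.isFiniteMeasure_map ν _
  obtain ⟨f, hf, hfμ⟩ := OxtobyUlam.exists_homeomorph_map_eq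
    (OxtobyUlam.isDiffuse_map_coe hμatom hμpos) (OxtobyUlam.isDiffuse_map_coe hνatom hνpos)
    (OxtobyUlam.map_coe_compl_openBox hmubd) (OxtobyUlam.map_coe_compl_openBox hnubd)
    (by simpa [hemb.map_apply] using htotal)
  have hQ : unitCube n = f ⁻¹' unitCube n := by
    have h := OxtobyUlam.symm_preimage_eq_of_subset hf (OxtobyUlam.openBox_subset_Icc (0, 1))
    ext x
    have hx := Set.ext_iff.1 h (f x)
    rw [Set.mem_preimage, Homeomorph.symm_apply_apply] at hx
    exact hx
  refine ⟨f.sets hQ, fun x hx => Subtype.ext (hf x hx), ?_⟩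
  rw [← hemb.comap_map (Measure.map (f.sets hQ) μ), ← hemb.comap_map ν, ← hfμ,
    Measure.map_map hemb.measurable (f.sets hQ).measurable,
    Measure.map_map f.measurable hemb.measurable]
  rfl
end
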